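/- arXiv:2306.01178 — 5 statements merged into one kernel-verified Lean document; each statement's English description precedes it below -/
import Mathlib

section
/- Let t_c > 0 and z_c ∈ (E₋, E₊) with −t_c < z_c < 0, and assume the normalized cusp equations: z_c + t_c·f₀(z_c)/(f₀(z_c)+1) = 0; 1 + t_c·f₀′(z_c)/(f₀(z_c)+1)² = 0; and f₀″(z_c) − 2·f₀′(z_c)²/(f₀(z_c)+1) = 0. Assume moreover that ∫_{−∞}^{E₋} ρ₀ > 0 and ∫_{E₊}^{∞} ρ₀ > 0. Then the constant A := t_c⁴·∫_ℝ ρ₀(x)/(4(z_c−x)⁴) dx − t_c⁴/(12(t_c+z_c)³) − t_c⁴/(12(−z_c)³) is strictly positive; equivalently, ∫_ℝ 6·ρ₀(x)/(z_c−x)⁴ dx > 2/(t_c+z_c)³ − 2/z_c³. -/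
open MeasureTheory Set

lemma integrable_of_hasCompactSupport_of_ae_mem_Icc {ρ : ℝ → ℝ} (hmeas : Measurable ρ)
    (hsupp : HasCompactSupport ρ) (hbd : ∀ᵐ x ∂(volume : Measure ℝ), ρ x ∈ Icc (0 : ℝ) 1) :
    Integrable ρ := by
  rw [← integrableOn_iff_integrable_of_support_subset (subset_tsupport ρ)]
  refine IntegrableOn.of_bound hsupp.isCompact.measure_lt_top hmeas.aestronglyMeasurable 1
    (ae_restrict_of_ae ?_)
  filter_upwards [hbd] with x hx
  rw [Real.norm_eq_abs, abs_of_nonneg hx.1]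
  exact hx.2

lemma exists_ball_lower_bound_of_mem_Ioo {l r z : ℝ} (hz : z ∈ Ioo l r) :
    ∃ δ > 0, ∀ y ∈ Metric.ball z δ, ∀ x ∉ Ioo l r, δ ≤ |y - x| := by
  refine ⟨min (z - l) (r - z) / 2, ?_, fun y hy x hx => ?_⟩
  · have := lt_min (sub_pos.2 hz.1) (sub_pos.2 hz.2)
    linarith
  · rw [Metric.mem_ball, Real.dist_eq, abs_lt] at hy
    have h1 := min_le_left (z - l) (r - z)
    have h2 := min_le_right (z - l) (r - z)
    by_cases hxl : l < x
    · have hxr : r ≤ x := by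
        by_contra! h
        exact hx ⟨hxl, h⟩
      rw [abs_sub_comm]
      exact le_trans (by linarith) (le_abs_self _)
    · exact le_trans (by linarith) (le_abs_self _)

section Stieltjes

variable {ρ : ℝ → ℝ} {l r : ℝ}

lemma integrable_div_sub_pow_of_gap (hmeas : Measurable ρ) (hint : Integrable ρ)
    (hgap : ∀ᵐ x ∂(volume : Measure ℝ), x ∈ Ioo l r → ρ x = 0) {z : ℝ} (hz : z ∈ Ioo l r)
    (k : ℕ) : Integrable fun x => ρ x / (z - x) ^ k := by
  obtain ⟨δ, hδ, hball⟩ := exists_ball_lower_bound_of_mem_Ioo hz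
  refine (hint.norm.div_const (δ ^ k)).mono'
    (hmeas.div (by fun_prop)).aestronglyMeasurable ?_
  filter_upwards [hgap] with x hx
  by_cases hxI : x ∈ Ioo l r
  · simp [hx hxI]
  · rw [norm_div, norm_pow, Real.norm_eq_abs (z - x)]
    have := hball z (Metric.mem_ball_self hδ) x hxI
    gcongr

lemma hasDerivAt_integral_div_sub_pow_of_gap (hmeas : Measurable ρ) (hint : Integrable ρ)
    (hgap : ∀ᵐ x ∂(volume : Measure ℝ), x ∈ Ioo l r → ρ x = 0) {z : ℝ} (hz : z ∈ Ioo l r)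
    (k : ℕ) : HasDerivAt (fun y => ∫ x, ρ x / (y - x) ^ k)
      (-(k * ∫ x, ρ x / (z - x) ^ (k + 1))) z := by
  obtain ⟨δ, hδ, hball⟩ := exists_ball_lower_bound_of_mem_Ioo hz
  have key := (hasDerivAt_integral_of_dominated_loc_of_deriv_le
    (F := fun y x => ρ x / (y - x) ^ k)
    (F' := fun y x => -(k * (ρ x / (y - x) ^ (k + 1))))
    (bound := fun x => k * (‖ρ x‖ / δ ^ (k + 1)))
    (μ := volume) (Metric.ball_mem_nhds z hδ)
    (Filter.Eventually.of_forall fun y => (hmeas.div (by fun_prop)).aestronglyMeasurable)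
    (integrable_div_sub_pow_of_gap hmeas hint hgap hz k)
    ((hmeas.div (by fun_prop)).const_mul _).neg.aestronglyMeasurable ?_
    ((hint.norm.div_const _).const_mul _) ?_).2
  · rwa [integral_neg, integral_const_mul] at key
  · filter_upwards [hgap] with x hx y hy
    by_cases hxI : x ∈ Ioo l r
    · simp [hx hxI]
    · rw [norm_neg, norm_mul, norm_div, norm_pow, Real.norm_eq_abs (y - x), Real.norm_natCast]
      have := hball y hy x hxI
      gcongr
  · filter_upwards [hgap] with x hx y hy
    by_cases hxI : x ∈ Ioo l r
    · simpa [hx hxI] using hasDerivAt_const y (0 : ℝ)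
    · have hne : y - x ≠ 0 := abs_pos.1 (hδ.trans_le (hball y hy x hxI))
      have h := (((hasDerivAt_id y).sub_const x).pow k).inv (pow_ne_zero k hne)
      have h' := h.const_mul (ρ x)
      refine h'.congr_deriv ?_
      rcases k with _ | k
      · simp
      · simp only [id, Nat.add_sub_cancel, Pi.pow_apply]
        field_simp
        ring

end Stieltjes

/-- The difference quotient at the origin of the primitive of `(v + p) (v - q)` is negative
throughout `[-p, q]`. -/
lemma primitive_quadratic_div_neg {p q u : ℝ} (hp : 0 < p) (hq : 0 < q) (h1 : -p ≤ u)
    (h2 : u ≤ q) : u ^ 2 / 3 + (p - q) * u / 2 - p * q < 0 := by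
  have h3 : (u + p) * (u - q) ≤ 0 :=
    mul_nonpos_of_nonneg_of_nonpos (by linarith) (by linarith)
  nlinarith [mul_pos hp hq, mul_nonneg (sub_nonneg.2 h2) hp.le,
    mul_nonneg (neg_le_iff_add_nonneg.1 h1) hq.le]

lemma hasDerivAt_primitive_sub_inv (p q z : ℝ) {x : ℝ} (hx : z - x ≠ 0) :
    HasDerivAt (fun y => (z - y)⁻¹ ^ 3 / 3 + (p - q) * (z - y)⁻¹ ^ 2 / 2 - p * q * (z - y)⁻¹)
      ((z - x)⁻¹ ^ 2 * (((z - x)⁻¹ + p) * ((z - x)⁻¹ - q))) x := by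
  have h : HasDerivAt (fun y => (z - y)⁻¹) ((z - x)⁻¹ ^ 2) x := by
    refine (((hasDerivAt_id x).const_sub z).inv hx).congr_deriv ?_
    simp
  refine ((((h.pow 3).div_const 3).add (((h.pow 2).const_mul (p - q)).div_const 2)).sub
    (h.const_mul (p * q))).congr_deriv ?_
  simp only [Nat.cast_ofNat]
  ring

lemma intervalIntegral_quadratic_sub_inv (p q z : ℝ) {s t : ℝ} (h : z ∉ uIcc s t) :
    IntervalIntegrable (fun x => (z - x)⁻¹ ^ 2 * (((z - x)⁻¹ + p) * ((z - x)⁻¹ - q)))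
      volume s t ∧
    ∫ x in s..t, (z - x)⁻¹ ^ 2 * (((z - x)⁻¹ + p) * ((z - x)⁻¹ - q)) =
      ((z - t)⁻¹ ^ 3 / 3 + (p - q) * (z - t)⁻¹ ^ 2 / 2 - p * q * (z - t)⁻¹) -
      ((z - s)⁻¹ ^ 3 / 3 + (p - q) * (z - s)⁻¹ ^ 2 / 2 - p * q * (z - s)⁻¹) := by
  have hne : ∀ x ∈ uIcc s t, z - x ≠ 0 := fun x hx h0 => h (sub_eq_zero.1 h0 ▸ hx)
  have hint : IntervalIntegrable
      (fun x => (z - x)⁻¹ ^ 2 * (((z - x)⁻¹ + p) * ((z - x)⁻¹ - q))) volume s t := by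
    have hc : ContinuousOn (fun x => (z - x)⁻¹) (uIcc s t) :=
      (continuousOn_const.sub continuousOn_id).inv₀ hne
    exact ((hc.pow 2).mul ((hc.add continuousOn_const).mul
      (hc.sub continuousOn_const))).intervalIntegrable
  exact ⟨hint, intervalIntegral.integral_eq_sub_of_hasDerivAt
    (fun x hx => hasDerivAt_primitive_sub_inv p q z (hne x hx)) hint⟩

/-- A bathtub inequality: among densities bounded by `1`, the integral against
`v ^ 2 * (v + p) * (v - q)`, `v = (z - x)⁻¹`, is minimal for the indicator of `v ∈ [-p, q]`,
and this minimum is not attained by a compactly supported density. -/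
lemma integral_mul_quadratic_sub_inv_gt {ρ : ℝ → ℝ} (hsupp : HasCompactSupport ρ)
    (hbd : ∀ᵐ x ∂(volume : Measure ℝ), ρ x ∈ Icc (0 : ℝ) 1)
    {p q z : ℝ} (hp : 0 < p) (hq : 0 < q)
    (hint : Integrable fun x =>
      ρ x * ((z - x)⁻¹ ^ 2 * (((z - x)⁻¹ + p) * ((z - x)⁻¹ - q)))) :
    (q ^ 3 / 3 + (p - q) * q ^ 2 / 2 - p * q * q) -
      ((-p) ^ 3 / 3 + (p - q) * (-p) ^ 2 / 2 - p * q * (-p)) <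
    ∫ x, ρ x * ((z - x)⁻¹ ^ 2 * (((z - x)⁻¹ + p) * ((z - x)⁻¹ - q))) := by
  set w : ℝ → ℝ := fun x => (z - x)⁻¹ ^ 2 * (((z - x)⁻¹ + p) * ((z - x)⁻¹ - q)) with hw
  obtain ⟨R₀, hR₀⟩ := hsupp.isCompact.isBounded.subset_closedBall z
  set R : ℝ := max (R₀ + 1) (p⁻¹ + q⁻¹)
  have hRR : R₀ < R := (lt_add_one R₀).trans_le (le_max_left _ _)
  have hRpq : p⁻¹ + q⁻¹ ≤ R := le_max_right _ _
  have hp' := inv_pos.2 hp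
  have hq' := inv_pos.2 hq
  have hR : 0 < R := by linarith
  have hRinv := inv_pos.2 hR
  have hRp : R⁻¹ ≤ p := inv_le_of_inv_le₀ hp (by linarith)
  have hRq : R⁻¹ ≤ q := inv_le_of_inv_le₀ hq (by linarith)
  have hvanish : ∀ x, R ≤ |x - z| → ρ x = 0 := fun x hx => by
    by_contra h
    have := hR₀ (subset_tsupport ρ h)
    rw [Metric.mem_closedBall, Real.dist_eq] at this
    linarith
  obtain ⟨hi1, he1⟩ := intervalIntegral_quadratic_sub_inv p q z (s := z - R) (t := z - q⁻¹)
    (by rw [uIcc_of_le (by linarith)]; exact fun h => by linarith [h.2])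
  obtain ⟨hi2, he2⟩ := intervalIntegral_quadratic_sub_inv p q z (s := z + p⁻¹) (t := z + R)
    (by rw [uIcc_of_le (by linarith)]; exact fun h => by linarith [h.1])
  rw [intervalIntegrable_iff_integrableOn_Ioc_of_le (by linarith)] at hi1 hi2
  rw [intervalIntegral.integral_of_le (by linarith)] at he1 he2
  have hdisj : Disjoint (Ioc (z - R) (z - q⁻¹)) (Ioc (z + p⁻¹) (z + R)) :=
    Set.disjoint_left.2 fun x h h' => by linarith [h.2, h'.1]
  have hle : ∫ x in Ioc (z - R) (z - q⁻¹) ∪ Ioc (z + p⁻¹) (z + R), w x ≤ ∫ x, ρ x * w x := by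
    rw [← integral_indicator (measurableSet_Ioc.union measurableSet_Ioc)]
    refine integral_mono_ae ((hi1.union hi2).integrable_indicator
      (measurableSet_Ioc.union measurableSet_Ioc)) hint ?_
    filter_upwards [hbd] with x hx
    by_cases hxT : x ∈ Ioc (z - R) (z - q⁻¹) ∪ Ioc (z + p⁻¹) (z + R)
    · rw [indicator_of_mem hxT]
      have hwx : w x ≤ 0 := by
        refine mul_nonpos_of_nonneg_of_nonpos (sq_nonneg _) ?_
        rcases hxT with h | h
        · have h0 : 0 < z - x := by linarith [h.2]
          have h1 := inv_pos.2 h0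
          have h2 : (z - x)⁻¹ ≤ q := inv_le_of_inv_le₀ hq (by linarith [h.2])
          exact mul_nonpos_of_nonneg_of_nonpos (by linarith) (by linarith)
        · have h0 : 0 < x - z := by linarith [h.1]
          have h1 := inv_pos.2 h0
          have h2 : (x - z)⁻¹ ≤ p := inv_le_of_inv_le₀ hp (by linarith [h.1])
          have h3 : (z - x)⁻¹ = -(x - z)⁻¹ := by rw [← neg_sub, inv_neg]
          rw [h3]
          exact mul_nonpos_of_nonneg_of_nonpos (by linarith) (by linarith)
      nlinarith [hx.2]
    · rw [indicator_of_notMem hxT]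
      by_cases hfar : R ≤ |x - z|
      · simp [hvanish x hfar]
      rw [not_le, abs_lt] at hfar
      refine mul_nonneg hx.1 ?_
      have hxl : z - q⁻¹ < x := by
        by_contra! h
        exact hxT (Or.inl ⟨by linarith, h⟩)
      have hxr : x ≤ z + p⁻¹ := by
        by_contra! h
        exact hxT (Or.inr ⟨h, by linarith⟩)
      rcases lt_trichotomy x z with h | h | h
      · refine mul_nonneg (sq_nonneg _) ?_
        have h2 : q ≤ (z - x)⁻¹ := (le_inv_comm₀ hq (by linarith)).2 (by linarith)
        exact mul_nonneg (by linarith) (by linarith)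
      · simp [hw, h]
      · refine mul_nonneg (sq_nonneg _) ?_
        have h2 : p ≤ (x - z)⁻¹ := (le_inv_comm₀ hp (by linarith)).2 (by linarith)
        have h3 : (z - x)⁻¹ = -(x - z)⁻¹ := by rw [← neg_sub, inv_neg]
        rw [h3]
        exact mul_nonneg_of_nonpos_of_nonpos (by linarith) (by linarith)
  rw [setIntegral_union hdisj measurableSet_Ioc hi1 hi2, he1, he2] at hle
  have e1 : (z - (z - q⁻¹))⁻¹ = q := by simp
  have e2 : (z - (z - R))⁻¹ = R⁻¹ := by simp
  have e3 : (z - (z + p⁻¹))⁻¹ = -p := by simp [inv_neg]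
  have e4 : (z - (z + R))⁻¹ = -R⁻¹ := by simp [inv_neg]
  rw [e1, e2, e3, e4] at hle
  have n1 := mul_neg_of_pos_of_neg hRinv
    (primitive_quadratic_div_neg (u := R⁻¹) hp hq (by linarith) hRq)
  have n2 := mul_neg_of_pos_of_neg hRinv
    (primitive_quadratic_div_neg (u := -R⁻¹) hp hq (by linarith) (by linarith))
  refine lt_of_lt_of_le ?_ hle
  linarith

/-- Lemma 4.7 of the paper (positivity of the Pearcey scaling constant): at a cusp point
`z_c` (normalized so that `x_c = 0`), if the density has positive mass on both sides of
the gap, then the constant `A` is strictly positive. -/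
theorem cusp_A_positive
    (β : ℝ) (hβ : β ∈ Ioo (0 : ℝ) 1)
    (ρ : ℝ → ℝ) (hmeas : Measurable ρ) (hsupp : HasCompactSupport ρ)
    (hbd : ∀ᵐ x ∂(volume : Measure ℝ), ρ x ∈ Icc (0 : ℝ) 1)
    (Em Ep : ℝ) (hE : Em < Ep)
    (hgap : ∀ᵐ x ∂(volume : Measure ℝ), x ∈ Ioo Em Ep → ρ x = 0)
    (tc zc : ℝ) (htc : 0 < tc) (hzc : zc ∈ Ioo Em Ep)
    (hzc' : -tc < zc) (hzc0 : zc < 0)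
    (m₀ : ℝ → ℝ) (hm₀ : m₀ = fun z => ∫ x : ℝ, ρ x / (z - x))
    (f₀ : ℝ → ℝ) (hf₀ : f₀ = fun z => β / (1 - β) * Real.exp (m₀ z))
    (cusp1 : zc + tc * f₀ zc / (f₀ zc + 1) = 0)
    (cusp2 : 1 + tc * deriv f₀ zc / (f₀ zc + 1) ^ 2 = 0)
    (cusp3 : deriv (deriv f₀) zc - 2 * (deriv f₀ zc) ^ 2 / (f₀ zc + 1) = 0)
    (hmassL : 0 < ∫ x in Iic Em, ρ x)
    (hmassR : 0 < ∫ x in Ici Ep, ρ x)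
    (A : ℝ)
    (hA : A = tc ^ 4 * (∫ x : ℝ, ρ x / (4 * (zc - x) ^ 4)) -
      tc ^ 4 / (12 * (tc + zc) ^ 3) - tc ^ 4 / (12 * (-zc) ^ 3)) :
    0 < A := by
  have hint := integrable_of_hasCompactSupport_of_ae_mem_Icc hmeas hsupp hbd
  have hI := fun k => integrable_div_sub_pow_of_gap hmeas hint hgap hzc k
  have hD := fun {z : ℝ} (hz : z ∈ Ioo Em Ep) k =>
    hasDerivAt_integral_div_sub_pow_of_gap hmeas hint hgap hz k
  have hm₀' : m₀ = fun z => ∫ x : ℝ, ρ x / (z - x) ^ 1 := by simp [hm₀]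
  have hdf : ∀ z ∈ Ioo Em Ep,
      HasDerivAt f₀ (f₀ z * -∫ x : ℝ, ρ x / (z - x) ^ 2) z := fun z hz => by
    have h := (hD hz 1).exp.const_mul (β / (1 - β))
    rw [hf₀, hm₀']
    refine h.congr_deriv ?_
    simp only [Nat.cast_one, one_mul]
    ring
  have hdf' : deriv f₀ =ᶠ[nhds zc] fun z => f₀ z * -∫ x : ℝ, ρ x / (z - x) ^ 2 := by
    filter_upwards [isOpen_Ioo.mem_nhds hzc] with z hz using (hdf z hz).deriv
  have hddf := hdf'.deriv_eq.trans ((hdf zc hzc).mul (hD hzc 2).neg).deriv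
  have hfpos : 0 < f₀ zc := by
    rw [hf₀]
    exact mul_pos (div_pos hβ.1 (sub_pos.2 hβ.2)) (Real.exp_pos _)
  rw [hddf] at cusp3
  rw [(hdf zc hzc).deriv] at cusp2 cusp3
  obtain ⟨a, rfl⟩ : ∃ a, zc = -a := ⟨-zc, (neg_neg zc).symm⟩
  obtain ⟨b, rfl⟩ : ∃ b, tc = a + b := ⟨tc - a, by ring⟩
  have ha : 0 < a := by linarith
  have hb : 0 < b := by linarith
  have hbt := integral_mul_quadratic_sub_inv_gt (z := -a) hsupp hbd (inv_pos.2 ha)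
    (inv_pos.2 hb)
  have hexp : (fun x => ρ x * ((-a - x)⁻¹ ^ 2 * (((-a - x)⁻¹ + a⁻¹) * ((-a - x)⁻¹ - b⁻¹)))) =
      fun x => ρ x / (-a - x) ^ 4 + (a⁻¹ - b⁻¹) * (ρ x / (-a - x) ^ 3) -
        a⁻¹ * b⁻¹ * (ρ x / (-a - x) ^ 2) := by
    ext x
    simp only [div_eq_mul_inv, ← inv_pow]
    ring
  rw [hexp] at hbt
  have hI43 : Integrable fun x =>
      ρ x / (-a - x) ^ 4 + (a⁻¹ - b⁻¹) * (ρ x / (-a - x) ^ 3) := (hI 4).add ((hI 3).const_mul _)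
  replace hbt := hbt (hI43.sub ((hI 2).const_mul _))
  rw [integral_sub hI43 ((hI 2).const_mul _),
    integral_add (hI 4) ((hI 3).const_mul _), integral_const_mul, integral_const_mul] at hbt
  have hA4 : ∫ x : ℝ, ρ x / (4 * (-a - x) ^ 4) = (∫ x : ℝ, ρ x / (-a - x) ^ 4) / 4 := by
    rw [← integral_div]
    congr 1 with x
    rw [div_div, mul_comm]
  rw [hA4] at hA
  simp only [Nat.cast_ofNat, Nat.reduceAdd, Pi.neg_apply] at cusp3
  generalize (∫ x : ℝ, ρ x / (-a - x) ^ 4) = M₄ at *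
  generalize (∫ x : ℝ, ρ x / (-a - x) ^ 3) = M₃ at *
  generalize (∫ x : ℝ, ρ x / (-a - x) ^ 2) = M₂ at *
  have hf : f₀ (-a) = a / b := by
    have : f₀ (-a) + 1 ≠ 0 := by linarith
    field_simp at cusp1 ⊢
    linarith
  rw [hf] at cusp2 cusp3
  have hab : 0 < a + b := htc
  have hab1 : a / b + 1 = (a + b) / b := by field_simp
  rw [hab1] at cusp2 cusp3
  have hM₂ : M₂ = a⁻¹ + b⁻¹ := by
    field_simp at cusp2 ⊢
    linarith
  subst hM₂
  have hM₃ : M₃ = (b⁻¹ ^ 2 - a⁻¹ ^ 2) / 2 := by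
    field_simp at cusp3 ⊢
    refine mul_left_cancel₀ hab.ne' ?_
    linear_combination cusp3
  subst hM₃
  have hM₄ : (a⁻¹ ^ 3 + b⁻¹ ^ 3) / 3 < M₄ := by
    linarith
  have hA' : A = (a + b) ^ 4 / 4 * (M₄ - (a⁻¹ ^ 3 + b⁻¹ ^ 3) / 3) := by
    rw [hA]
    have : a + b + -a = b := by ring
    rw [this, neg_neg]
    field_simp
    ring
  rw [hA']
  exact mul_pos (by positivity) (sub_pos.2 hM₄)
end

section
/- Let t_c > 0 and z_c ∈ (E₋, E₊) with −t_c < z_c < 0, and assume the normalized cusp equations: z_c + t_c·f₀(z_c)/(f₀(z_c)+1) = 0; 1 + t_c·f₀′(z_c)/(f₀(z_c)+1)² = 0; and f₀″(z_c) − 2·f₀′(z_c)²/(f₀(z_c)+1) = 0. Then ∫_{z_c}^{0} ρ₀(x) dx > 0 and ∫_{−t_c}^{z_c} ρ₀(x) dx > 0; in other words, ρ₀ cannot vanish almost everywhere on (z_c, 0), nor almost everywhere on (−t_c, z_c). In particular, the edges of the gap of ρ₀ around z_c satisfy E₊ < 0 and E₋ > −t_c whenever (E₋, E₊) is the maximal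 interval containing z_c on which ρ₀ vanishes almost everywhere. -/
open MeasureTheory Set

/-- `y ↦ 1 / y ^ (n + 2)` is integrable on `(a, ∞)`, with the expected integral. -/
lemma integrableOn_and_integral_Ioi_one_div_pow (n : ℕ) {a : ℝ} (ha : 0 < a) :
    IntegrableOn (fun y : ℝ => 1 / y ^ (n + 2)) (Ioi a) ∧
      ∫ y in Ioi a, 1 / y ^ (n + 2) = 1 / ((n + 1) * a ^ (n + 1)) := by
  have hlt : (-(n + 2 : ℕ) : ℝ) < -1 := by push_cast; linarith [n.cast_nonneg (α := ℝ)]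
  have heq : EqOn (fun y : ℝ => y ^ (-(n + 2 : ℕ) : ℝ)) (fun y => 1 / y ^ (n + 2)) (Ioi a) := by
    intro y hy
    have hy0 : 0 < y := ha.trans hy
    simp only [Real.rpow_neg hy0.le, Real.rpow_natCast, one_div]
  refine ⟨(integrableOn_Ioi_rpow_of_lt hlt ha).congr_fun heq measurableSet_Ioi, ?_⟩
  rw [← setIntegral_congr_fun measurableSet_Ioi heq, integral_Ioi_rpow_of_lt hlt ha]
  have h1 : (-(n + 2 : ℕ) : ℝ) + 1 = -((n + 1 : ℕ) : ℝ) := by push_cast; ring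
  rw [h1, Real.rpow_neg ha.le, Real.rpow_natCast]
  push_cast
  have : (n : ℝ) + 1 ≠ 0 := by positivity
  field_simp

/-- The reflected version of `integrableOn_and_integral_Ioi_one_div_pow`. -/
lemma integrableOn_and_integral_Iic_one_div_pow (n : ℕ) {b : ℝ} (hb : 0 < b) :
    IntegrableOn (fun y : ℝ => 1 / y ^ (n + 2)) (Iic (-b)) ∧
      ∫ y in Iic (-b), 1 / y ^ (n + 2) = (-1) ^ n / ((n + 1) * b ^ (n + 1)) := by
  obtain ⟨hi, he⟩ := integrableOn_and_integral_Ioi_one_div_pow n hb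
  have heq : (fun y : ℝ => 1 / y ^ (n + 2)) = fun y => (-1) ^ n * (1 / (-y) ^ (n + 2)) := by
    funext y
    rw [neg_pow y]
    rcases neg_one_pow_eq_or ℝ n with h | h <;> simp [pow_add, h]
  constructor
  · rw [heq]
    refine Integrable.const_mul ?_ _
    have hi' : IntegrableOn (fun y : ℝ => 1 / y ^ (n + 2)) (Ici b) := by
      rwa [integrableOn_Ici_iff_integrableOn_Ioi]
    simpa [IntegrableOn] using hi'.comp_neg
  · rw [heq, integral_const_mul, integral_comp_neg_Iic (-b) (fun y : ℝ => 1 / y ^ (n + 2)),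
      neg_neg, he]
    ring

/-- If a density `0 ≤ σ ≤ 1` with support bounded above has the same second and third inverse
moments as the indicator of the complement of `(-b, a]`, then it has positive mass in `(0, a)`. -/
lemma setIntegral_Ioo_pos_of_inverse_moments {σ : ℝ → ℝ} (hσ : Integrable σ)
    (hbd : ∀ᵐ y, σ y ∈ Icc (0 : ℝ) 1) {R : ℝ} (hR : ∀ y, R < y → σ y = 0)
    {a b : ℝ} (ha : 0 < a) (hb : 0 < b)
    (hi2 : Integrable fun y => σ y / y ^ 2) (hi3 : Integrable fun y => σ y / y ^ 3)
    (he2 : ∫ y, σ y / y ^ 2 = 1 / a + 1 / b)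
    (he3 : ∫ y, σ y / y ^ 3 = (1 / a ^ 2 - 1 / b ^ 2) / 2) :
    0 < ∫ y in Ioo 0 a, σ y := by
  have hnn : ∀ᵐ y ∂(volume.restrict (Ioo 0 a)), 0 ≤ σ y :=
    ae_restrict_of_ae (hbd.mono fun y hy => hy.1)
  refine lt_of_le_of_ne (integral_nonneg_of_ae hnn) fun h0 => ?_
  have hzero : ∀ᵐ y, y ∈ Ioo 0 a → σ y = 0 :=
    (ae_restrict_iff' measurableSet_Ioo).1
      ((setIntegral_eq_zero_iff_of_nonneg_ae hnn hσ.integrableOn).1 h0.symm)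
  set w : ℝ → ℝ := fun y => 1 / y ^ 3 + 1 / b * (1 / y ^ 2) with hw
  set S : Set ℝ := Ioi a ∪ Iic (-b) with hS
  have hSm : MeasurableSet S := measurableSet_Ioi.union measurableSet_Iic
  have hdisj : Disjoint (Ioi a) (Iic (-b)) :=
    Set.disjoint_left.2 fun y hy hy' => by
      simp only [mem_Ioi, mem_Iic] at hy hy'; linarith
  obtain ⟨p2, q2⟩ := integrableOn_and_integral_Ioi_one_div_pow 0 ha
  obtain ⟨p3, q3⟩ := integrableOn_and_integral_Ioi_one_div_pow 1 ha
  obtain ⟨r2, s2⟩ := integrableOn_and_integral_Iic_one_div_pow 0 hb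
  obtain ⟨r3, s3⟩ := integrableOn_and_integral_Iic_one_div_pow 1 hb
  norm_num only [zero_add, Nat.reduceAdd] at p2 q2 p3 q3 r2 s2 r3 s3
  have hwI : IntegrableOn w (Ioi a) := p3.add (p2.const_mul _)
  have hwJ : IntegrableOn w (Iic (-b)) := r3.add (r2.const_mul _)
  have hwS : IntegrableOn w S := hwI.union hwJ
  have hwint : ∫ y in S, w y = (1 / a ^ 2 - 1 / b ^ 2) / 2 + 1 / b * (1 / a + 1 / b) := by
    rw [hS, setIntegral_union hdisj measurableSet_Iic hwI hwJ, hw,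
      integral_add p3 (p2.const_mul _), integral_add r3 (r2.const_mul _),
      integral_const_mul, integral_const_mul, q2, q3, s2, s3]
    norm_num
    field_simp
    ring
  have hσw : Integrable fun y => σ y / y ^ 3 + 1 / b * (σ y / y ^ 2) := hi3.add (hi2.const_mul _)
  have hσwint : ∫ y, (σ y / y ^ 3 + 1 / b * (σ y / y ^ 2)) =
      (1 / a ^ 2 - 1 / b ^ 2) / 2 + 1 / b * (1 / a + 1 / b) := by
    rw [integral_add hi3 (hi2.const_mul _), integral_const_mul, he2, he3]
  set D : ℝ → ℝ := fun y => S.indicator w y - (σ y / y ^ 3 + 1 / b * (σ y / y ^ 2)) with hD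
  have hDi : Integrable D := (hwS.integrable_indicator hSm).sub hσw
  have hDint : ∫ y, D y = 0 := by
    rw [hD, integral_sub (hwS.integrable_indicator hSm) hσw, integral_indicator hSm, hwint,
      hσwint, sub_self]
  have hwfac : ∀ y, y ≠ 0 → w y = (b + y) / (b * y ^ 3) := by
    intro y hy
    simp only [hw]
    field_simp
  have hDnn : 0 ≤ᵐ[volume] D := by
    have hne0 : ∀ᵐ y : ℝ, y ≠ 0 := by simp [ae_iff]
    have hnea : ∀ᵐ y : ℝ, y ≠ a := by simp [ae_iff]
    filter_upwards [hbd, hzero, hne0, hnea] with y hy hz h0 hya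
    have hsplit : σ y / y ^ 3 + 1 / b * (σ y / y ^ 2) = σ y * w y := by simp only [hw]; ring
    simp only [hD, Pi.zero_apply, hsplit]
    by_cases hyS : y ∈ S
    · rw [indicator_of_mem hyS]
      have : 0 ≤ w y := by
        rw [hwfac y h0]
        rcases hyS with h | h
        · have : 0 < y := ha.trans h
          positivity
        · simp only [mem_Iic] at h
          have h3 : y ^ 3 ≤ 0 := (Odd.pow_neg (by decide) (by linarith)).le
          exact div_nonneg_of_nonpos (by linarith) (mul_nonpos_of_nonneg_of_nonpos hb.le h3)
      nlinarith [hy.2]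
    · rw [indicator_of_notMem hyS]
      simp only [hS, mem_union, mem_Ioi, mem_Iic, not_or, not_lt, not_le] at hyS
      rcases lt_or_gt_of_ne h0 with h | h
      · have h3 : y ^ 3 ≤ 0 := (Odd.pow_neg (by decide) h).le
        have : w y ≤ 0 := by
          rw [hwfac y h0]
          exact div_nonpos_of_nonneg_of_nonpos (by linarith)
            (mul_nonpos_of_nonneg_of_nonpos hb.le h3)
        nlinarith [hy.1]
      · rw [hz ⟨h, lt_of_le_of_ne hyS.1 hya⟩]
        simp
  have hD0 : D =ᵐ[volume] 0 := (integral_eq_zero_iff_of_nonneg_ae hDnn hDi).1 hDint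
  have hnull : ∀ᵐ y : ℝ, y ∉ Ioi (max a R) := by
    filter_upwards [hD0] with y hy hyM
    have hya : a < y := lt_of_le_of_lt (le_max_left _ _) hyM
    have hy0 : 0 < y := ha.trans hya
    simp only [hD, Pi.zero_apply, hR y (lt_of_le_of_lt (le_max_right _ _) hyM),
      indicator_of_mem (show y ∈ S from Or.inl hya), hwfac y hy0.ne'] at hy
    have : 0 < (b + y) / (b * y ^ 3) := by positivity
    simp at hy
    rcases hy with h | h | h <;> linarith
  have := measure_eq_zero_iff_ae_notMem.2 hnull
  simp at this

/-- Differentiation under the integral sign for inverse powers of `z - x` against a density which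
vanishes near `z`. -/
lemma hasDerivAt_integral_div_sub_pow {ρ : ℝ → ℝ} (hρ : Integrable ρ) {l r : ℝ}
    (hgap : ∀ᵐ x, x ∈ Ioo l r → ρ x = 0) (n : ℕ) {z : ℝ} (hz : z ∈ Ioo l r) :
    Integrable (fun x => ρ x / (z - x) ^ n) ∧
      HasDerivAt (fun z => ∫ x, ρ x / (z - x) ^ n)
        (-n * ∫ x, ρ x / (z - x) ^ (n + 1)) z := by
  obtain ⟨ε, hε, hball⟩ := Metric.isOpen_iff.1 isOpen_Ioo z hz
  have hfar : ∀ᵐ x, ∀ z' ∈ Metric.ball z (ε / 2), ρ x = 0 ∨ ε / 2 ≤ |z' - x| := by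
    filter_upwards [hgap] with x hx z' hz'
    by_cases hxb : x ∈ Metric.ball z ε
    · exact Or.inl (hx (hball hxb))
    · right
      rw [Metric.mem_ball, Real.dist_eq] at hz'
      rw [Metric.mem_ball, Real.dist_eq, not_lt] at hxb
      have := abs_sub_le x z' z
      rw [abs_sub_comm x z'] at this
      linarith
  have hmeas : ∀ (k : ℕ) (z' : ℝ), AEStronglyMeasurable (fun x => ρ x / (z' - x) ^ k) volume :=
    fun k z' => (hρ.aemeasurable.div (by fun_prop)).aestronglyMeasurable
  have hbound : ∀ᵐ x, ∀ z' ∈ Metric.ball z (ε / 2), ∀ k : ℕ,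
      ‖ρ x / (z' - x) ^ k‖ ≤ |ρ x| * (1 / (ε / 2) ^ k) := by
    filter_upwards [hfar] with x hx z' hz' k
    rcases hx z' hz' with h | h
    · simp [h]
    · rw [norm_div, norm_pow, Real.norm_eq_abs, Real.norm_eq_abs, mul_one_div]
      gcongr
  have hzb : z ∈ Metric.ball z (ε / 2) := Metric.mem_ball_self (by positivity)
  have hint : Integrable (fun x => ρ x / (z - x) ^ n) :=
    (hρ.abs.mul_const (1 / (ε / 2) ^ n)).mono' (hmeas n z)
      (hbound.mono fun x hx => hx z hzb n)
  refine ⟨hint, ?_⟩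
  rw [← integral_const_mul]
  refine (hasDerivAt_integral_of_dominated_loc_of_deriv_le
    (F := fun z x => ρ x / (z - x) ^ n) (F' := fun z x => -n * (ρ x / (z - x) ^ (n + 1)))
    (bound := fun x => n * (|ρ x| * (1 / (ε / 2) ^ (n + 1))))
    (Metric.ball_mem_nhds z (by positivity : 0 < ε / 2))
    (Filter.Eventually.of_forall fun z' => hmeas n z') hint ((hmeas _ z).const_mul _) ?_
    ((hρ.abs.mul_const _).const_mul _) ?_).2
  · filter_upwards [hbound] with x hx z' hz'
    rw [norm_mul, norm_neg, Real.norm_natCast]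
    exact mul_le_mul_of_nonneg_left (hx z' hz' _) n.cast_nonneg
  · filter_upwards [hfar] with x hx z' hz'
    rcases hx z' hz' with h | h
    · simpa [h] using hasDerivAt_const z' (0 : ℝ)
    · have hne : z' - x ≠ 0 := abs_pos.1 (by linarith)
      have h1 := (((hasDerivAt_id z').sub_const x).pow n).inv (pow_ne_zero n hne)
      convert! h1.const_mul (ρ x) using 1
      rcases n with _ | n
      · simp
      · simp
        field_simp
        ring

/-- From the proof of Lemma 4.7 of the paper: at a cusp point `z_c` (normalized so that
`x_c = 0`), the density `ρ₀` must have positive mass both in `(z_c, 0)` and in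
`(−t_c, z_c)`; in particular the edges of the gap around `z_c` satisfy `E₊ < 0` and
`E₋ > −t_c`. -/
theorem cusp_gap_edges
    (β : ℝ) (hβ : β ∈ Ioo (0 : ℝ) 1)
    (ρ : ℝ → ℝ) (hmeas : Measurable ρ) (hsupp : HasCompactSupport ρ)
    (hbd : ∀ᵐ x ∂(volume : Measure ℝ), ρ x ∈ Icc (0 : ℝ) 1)
    (Em Ep : ℝ) (hE : Em < Ep)
    (hgap : ∀ᵐ x ∂(volume : Measure ℝ), x ∈ Ioo Em Ep → ρ x = 0)
    (tc zc : ℝ) (htc : 0 < tc) (hzc : zc ∈ Ioo Em Ep)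
    (hzc' : -tc < zc) (hzc0 : zc < 0)
    (m₀ : ℝ → ℝ) (hm₀ : m₀ = fun z => ∫ x : ℝ, ρ x / (z - x))
    (f₀ : ℝ → ℝ) (hf₀ : f₀ = fun z => β / (1 - β) * Real.exp (m₀ z))
    (cusp1 : zc + tc * f₀ zc / (f₀ zc + 1) = 0)
    (cusp2 : 1 + tc * deriv f₀ zc / (f₀ zc + 1) ^ 2 = 0)
    (cusp3 : deriv (deriv f₀) zc - 2 * (deriv f₀ zc) ^ 2 / (f₀ zc + 1) = 0) :
    (0 < ∫ x in Ioo zc 0, ρ x) ∧ (0 < ∫ x in Ioo (-tc) zc, ρ x) := by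
  obtain ⟨R, hR⟩ := hsupp.isCompact.isBounded.subset_closedBall 0
  have hρ0 : ∀ x, R < |x| → ρ x = 0 := fun x hx => by
    by_contra h
    have := hR (subset_tsupport ρ h)
    rw [mem_closedBall_zero_iff, Real.norm_eq_abs] at this
    linarith
  have hρ : Integrable ρ := by
    have hon : IntegrableOn ρ (Icc (-R) R) := by
      refine Measure.integrableOn_of_bounded (M := 1) (by simp) hmeas.aestronglyMeasurable ?_
      refine ae_restrict_of_ae (hbd.mono fun x hx => ?_)
      rw [Real.norm_eq_abs, abs_of_nonneg hx.1]
      exact hx.2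
    refine hon.integrable_of_forall_notMem_eq_zero fun x hx => hρ0 x ?_
    rw [← not_le, abs_le]
    exact hx
  have hd1 : ∀ z ∈ Ioo Em Ep, HasDerivAt m₀ (-∫ x, ρ x / (z - x) ^ 2) z := by
    intro z hz
    have := (hasDerivAt_integral_div_sub_pow hρ hgap 1 hz).2
    simpa [hm₀] using this
  have hf1 : ∀ z ∈ Ioo Em Ep, HasDerivAt f₀ (f₀ z * -∫ x, ρ x / (z - x) ^ 2) z := by
    intro z hz
    have := ((hd1 z hz).exp).const_mul (β / (1 - β))
    rw [← mul_assoc] at this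
    simpa only [hf₀] using this
  have hd2 := (hasDerivAt_integral_div_sub_pow hρ hgap 2 hzc).2
  have hI2 := (hasDerivAt_integral_div_sub_pow hρ hgap 2 hzc).1
  have hI3 := (hasDerivAt_integral_div_sub_pow hρ hgap 3 hzc).1
  have hderiv : deriv f₀ =ᶠ[nhds zc] fun z => f₀ z * -∫ x, ρ x / (z - x) ^ 2 := by
    filter_upwards [isOpen_Ioo.mem_nhds hzc] with z hz using (hf1 z hz).deriv
  rw [hderiv.deriv_eq, ((hf1 zc hzc).fun_mul hd2.fun_neg).deriv, (hf1 zc hzc).deriv] at cusp3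
  rw [(hf1 zc hzc).deriv] at cusp2
  have hfpos : 0 < f₀ zc := by
    rw [hf₀]
    have := hβ.1
    have := sub_pos.2 hβ.2
    positivity
  set A := ∫ x, ρ x / (zc - x) ^ 2 with hA
  set B := ∫ x, ρ x / (zc - x) ^ (2 + 1) with hB
  obtain ⟨a, ha⟩ : ∃ a, a = -zc := ⟨_, rfl⟩
  obtain ⟨b, hb⟩ : ∃ b, b = tc + zc := ⟨_, rfl⟩
  have ha0 : 0 < a := by linarith
  have hb0 : 0 < b := by linarith
  have htab : tc = a + b := by linarith
  have hfab : f₀ zc = a / b := by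
    have : f₀ zc + 1 ≠ 0 := by positivity
    rw [eq_div_iff hb0.ne', hb, ha]
    field_simp at cusp1
    linarith
  rw [hfab, htab] at cusp2
  rw [hfab] at cusp3
  have hAval : A = 1 / a + 1 / b := by
    field_simp at cusp2 ⊢
    linarith
  have hBval : B = -((1 / a ^ 2 - 1 / b ^ 2) / 2) := by
    have h2B : 2 * B = A ^ 2 * (a - b) / (a + b) := by
      push_cast at cusp3
      field_simp at cusp3 ⊢
      refine mul_left_cancel₀ ha0.ne' ?_
      linarith
    rw [hAval] at h2B
    field_simp at h2B ⊢
    refine mul_right_cancel₀ (add_pos ha0 hb0).ne' ?_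
    linarith
  constructor
  · have hcube : (fun y => ρ (zc + y) / y ^ 3) =
        fun y => -(ρ (zc + y) / (zc - (zc + y)) ^ (2 + 1)) := by
      funext y
      rw [sub_add_cancel_left, Odd.neg_pow (by decide), div_neg, neg_neg]
    have key := setIntegral_Ioo_pos_of_inverse_moments (σ := fun y => ρ (zc + y))
      (hρ.comp_add_left zc)
      ((measurePreserving_add_left volume zc).quasiMeasurePreserving.ae hbd) (R := R - zc)
      (fun y hy => hρ0 _ (lt_of_lt_of_le (by linarith) (le_abs_self _))) ha0 hb0
      (by simpa using hI2.comp_add_left zc)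
      (by rw [hcube]; exact (hI3.comp_add_left zc).neg)
      (by
        rw [← hAval, hA, ← integral_add_left_eq_self (fun x => ρ x / (zc - x) ^ 2) zc]
        simp)
      (by
        rw [hcube, integral_neg, integral_add_left_eq_self (fun x => ρ x / (zc - x) ^ (2 + 1)) zc,
          ← hB, hBval, neg_neg])
    rw [← integral_Ioc_eq_integral_Ioo, ← intervalIntegral.integral_of_le ha0.le,
      intervalIntegral.integral_comp_add_left (fun x => ρ x), ha,
      intervalIntegral.integral_of_le (by linarith), integral_Ioc_eq_integral_Ioo] at key
    simpa using key
  · have key := setIntegral_Ioo_pos_of_inverse_moments (σ := fun y => ρ (zc - y))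
      (hρ.comp_sub_left zc)
      ((Measure.measurePreserving_sub_left volume zc).quasiMeasurePreserving.ae hbd) (R := R + zc)
      (fun y hy => hρ0 _ (lt_of_lt_of_le (by linarith) (neg_le_abs _))) hb0 ha0
      (by simpa using hI2.comp_sub_left zc)
      (by simpa using hI3.comp_sub_left zc)
      (by
        rw [add_comm, ← hAval, hA,
          ← integral_sub_left_eq_self (fun x => ρ x / (zc - x) ^ 2) volume zc]
        simp)
      (by
        rw [show (1 / b ^ 2 - 1 / a ^ 2) / 2 = B by rw [hBval]; ring, hB,
          ← integral_sub_left_eq_self (fun x => ρ x / (zc - x) ^ (2 + 1)) volume zc]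
        simp)
    rw [← integral_Ioc_eq_integral_Ioo, ← intervalIntegral.integral_of_le hb0.le,
      intervalIntegral.integral_comp_sub_left (fun x => ρ x), hb,
      intervalIntegral.integral_of_le (by linarith), integral_Ioc_eq_integral_Ioo] at key
    simpa using key
end

section
/- Let β ∈ (0,1) and let ρ₀ : ℝ → ℝ be measurable with 0 ≤ ρ₀ ≤ 1 almost everywhere and 0 < ∫_ℝ ρ₀ < ∞. Then there exists a family (ρ_t)_{t ≥ 0} of measurable functions ρ_t : ℝ → [0,1] with ∫_ℝ ρ_t < ∞ for each t and ρ_0 = ρ₀ almost everywhere, such that the function f(t, z) := (β/(1−β))·exp(∫_ℝ ρ_t(x)/(z−x) dx), defined for t ≥ 0 and z ∈ ℍ, satisfies: Im f(t, z) < 0 for all t ≥ 0 and z ∈ ℍ; for each t ≥ 0, the map z ↦ f(t, z) is holomorphic on ℍ; for each z ∈ ℍ, the map t ↦ f(t, z) is differentiable on (0, ∞); and the complex Burgers equation ∂_t f(t, z) + (f(t, z)/(f(t, z)+1))·∂_z f(t, z) = 0 holds for every t > 0 and z ∈ ℍ. -/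
open MeasureTheory

/-- The complex slope built from a time-dependent family of densities `ρ` and a drift
parameter `β`: `f(t,z) = (β/(1−β))·exp(∫ ρ_t(x)/(z−x) dx)`. -/
noncomputable def slopeF (β : ℝ) (ρ : ℝ → ℝ → ℝ) (t : ℝ) (z : ℂ) : ℂ :=
  ((β / (1 - β) : ℝ) : ℂ) * Complex.exp (∫ x : ℝ, (ρ t x : ℂ) / (z - (x : ℂ)))

open Filter Topology Set
open scoped ComplexConjugate

/-- `π` times the Poisson kernel of the upper half-plane. -/
noncomputable def halfPlaneKernel (z : ℂ) (x : ℝ) : ℝ := z.im / ((x - z.re) ^ 2 + z.im ^ 2)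

lemma halfPlaneKernel_eq {z : ℂ} (hz : 0 < z.im) (x : ℝ) :
    halfPlaneKernel z x = z.im⁻¹ * (1 + ((x - z.re) / z.im) ^ 2)⁻¹ := by
  unfold halfPlaneKernel
  have : 0 < (x - z.re) ^ 2 + z.im ^ 2 := by positivity
  field_simp
  ring

lemma halfPlaneKernel_pos {z : ℂ} (hz : 0 < z.im) (x : ℝ) : 0 < halfPlaneKernel z x := by
  unfold halfPlaneKernel; positivity

lemma halfPlaneKernel_le {z : ℂ} (hz : 0 < z.im) (x : ℝ) : halfPlaneKernel z x ≤ z.im⁻¹ := by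
  unfold halfPlaneKernel
  rw [div_le_iff₀ (by positivity), inv_mul_eq_div, le_div_iff₀ hz]
  nlinarith [sq_nonneg (x - z.re)]

lemma continuous_halfPlaneKernel {z : ℂ} (hz : 0 < z.im) : Continuous (halfPlaneKernel z) := by
  unfold halfPlaneKernel
  exact continuous_const.div (by fun_prop) fun x => by positivity

lemma integrable_halfPlaneKernel {z : ℂ} (hz : 0 < z.im) : Integrable (halfPlaneKernel z) := by
  have h := ((integrable_inv_one_add_sq.comp_div hz.ne').comp_sub_right z.re).const_mul z.im⁻¹
  exact h.congr (Eventually.of_forall fun x => (halfPlaneKernel_eq hz x).symm)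

lemma integral_halfPlaneKernel {z : ℂ} (hz : 0 < z.im) :
    ∫ x, halfPlaneKernel z x = Real.pi := by
  simp_rw [halfPlaneKernel_eq hz]
  rw [integral_const_mul,
    integral_sub_right_eq_self (fun x : ℝ => (1 + (x / z.im) ^ 2)⁻¹) z.re,
    Measure.integral_comp_div (fun x : ℝ => (1 + x ^ 2)⁻¹), integral_univ_inv_one_add_sq]
  simp [abs_of_pos hz, hz.ne']

lemma memLp_halfPlaneKernel {z : ℂ} (hz : 0 < z.im) : MemLp (halfPlaneKernel z) 2 := by
  rw [memLp_two_iff_integrable_sq (continuous_halfPlaneKernel hz).aestronglyMeasurable]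
  refine ((integrable_halfPlaneKernel hz).const_mul z.im⁻¹).mono'
    ((continuous_halfPlaneKernel hz).pow 2).aestronglyMeasurable (Eventually.of_forall fun x => ?_)
  have h0 := (halfPlaneKernel_pos hz x).le
  rw [Real.norm_eq_abs, abs_of_nonneg (by positivity), sq]
  exact mul_le_mul_of_nonneg_right (halfPlaneKernel_le hz x) h0

lemma integrable_halfPlaneKernel_mul {ρ : ℝ → ℝ} (hρ : Integrable ρ) {z : ℂ} (hz : 0 < z.im) :
    Integrable fun x => halfPlaneKernel z x * ρ x := by
  refine hρ.bdd_mul (c := z.im⁻¹) (continuous_halfPlaneKernel hz).aestronglyMeasurable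
    (Eventually.of_forall fun x => ?_)
  rw [Real.norm_eq_abs, abs_of_pos (halfPlaneKernel_pos hz x)]
  exact halfPlaneKernel_le hz x

lemma im_le_norm_sub_ofReal {z : ℂ} (x : ℝ) : z.im ≤ ‖z - x‖ := by
  have := (le_abs_self _).trans (Complex.abs_im_le_norm (z - x))
  simpa using this

lemma im_ofReal_div_sub {z : ℂ} (c x : ℝ) :
    ((c : ℂ) / (z - x)).im = -(halfPlaneKernel z x * c) := by
  simp [Complex.div_im, Complex.normSq_apply, halfPlaneKernel]
  ring

/-- The Stieltjes transform of a density. -/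
noncomputable def stieltjes (ρ : ℝ → ℝ) (z : ℂ) : ℂ := ∫ x : ℝ, (ρ x : ℂ) / (z - x)

section Stieltjes

variable {ρ : ℝ → ℝ}

lemma norm_stieltjes_integrand_le {z : ℂ} {y : ℝ} (hy : 0 < y) (hz : y ≤ z.im) (x : ℝ) :
    ‖(ρ x : ℂ) / (z - x)‖ ≤ ‖ρ x‖ / y := by
  rw [norm_div, Complex.norm_real]
  gcongr
  exact hz.trans (im_le_norm_sub_ofReal x)

lemma aestronglyMeasurable_stieltjes_integrand (hρ : Integrable ρ) (z : ℂ) :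
    AEStronglyMeasurable fun x : ℝ => (ρ x : ℂ) / (z - x) := by
  simp only [div_eq_mul_inv]
  refine hρ.ofReal.aestronglyMeasurable.mul ?_
  exact (by fun_prop : Measurable fun x : ℝ => (z - (x : ℂ))⁻¹).aestronglyMeasurable

lemma integrable_stieltjes (hρ : Integrable ρ) {z : ℂ} (hz : 0 < z.im) :
    Integrable fun x : ℝ => (ρ x : ℂ) / (z - x) := by
  refine (hρ.norm.div_const z.im).mono' ?_
    (Eventually.of_forall fun x => norm_stieltjes_integrand_le hz le_rfl x)
  exact aestronglyMeasurable_stieltjes_integrand hρ z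

lemma norm_stieltjes_le (hρ : Integrable ρ) {z : ℂ} (hz : 0 < z.im) :
    ‖stieltjes ρ z‖ ≤ (∫ x, ‖ρ x‖) / z.im := by
  rw [← integral_div]
  exact norm_integral_le_of_norm_le (hρ.norm.div_const _)
    (Eventually.of_forall fun x => norm_stieltjes_integrand_le hz le_rfl x)

lemma im_stieltjes (hρ : Integrable ρ) {z : ℂ} (hz : 0 < z.im) :
    (stieltjes ρ z).im = -∫ x, halfPlaneKernel z x * ρ x := by
  have h := integral_im (integrable_stieltjes hρ hz)
  simp only [RCLike.im_to_complex, im_ofReal_div_sub, integral_neg] at h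
  exact h.symm

lemma differentiableOn_stieltjes (hρ : Integrable ρ) :
    DifferentiableOn ℂ (stieltjes ρ) {z | 0 < z.im} := by
  intro z hz
  have hz' : 0 < z.im := hz
  have hd := hasDerivAt_integral_of_dominated_loc_of_deriv_le (μ := volume)
    (F := fun (w : ℂ) (x : ℝ) => (ρ x : ℂ) / (w - x))
    (F' := fun (w : ℂ) (x : ℝ) => -(ρ x : ℂ) / (w - x) ^ 2) (x₀ := z)
    (s := {w : ℂ | z.im / 2 < w.im}) (bound := fun x => ‖ρ x‖ / (z.im / 2) ^ 2)
    ((isOpen_lt continuous_const Complex.continuous_im).mem_nhds (by simpa using half_lt_self hz'))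
    (Eventually.of_forall (aestronglyMeasurable_stieltjes_integrand hρ)) (integrable_stieltjes hρ hz') ?_ ?_ (hρ.norm.div_const _) ?_
  · exact hd.2.differentiableAt.differentiableWithinAt
  · simp only [div_eq_mul_inv]
    refine hρ.ofReal.neg.aestronglyMeasurable.mul ?_
    exact (by fun_prop : Measurable fun x : ℝ => ((z - (x : ℂ)) ^ 2)⁻¹).aestronglyMeasurable
  · refine Eventually.of_forall fun x w hw => ?_
    have hw' : z.im / 2 < w.im := hw
    rw [norm_div, norm_neg, Complex.norm_real, norm_pow]
    gcongr
    exact hw'.le.trans (im_le_norm_sub_ofReal x)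
  · refine Eventually.of_forall fun x w hw => ?_
    have hw' : z.im / 2 < w.im := hw
    have hne : w - x ≠ 0 := norm_pos_iff.1 ((half_pos hz').trans
      (hw'.trans_le (im_le_norm_sub_ofReal x)))
    exact ((hasDerivAt_const w (ρ x : ℂ)).div ((hasDerivAt_id w).sub_const (x : ℂ))
      hne).congr_deriv (by simp)

variable (hρ : Integrable ρ) (hb : ∀ᵐ x, ρ x ∈ Icc (0 : ℝ) 1)

include hρ hb

lemma im_stieltjes_neg (hpos : 0 < ∫ x, ρ x) {z : ℂ} (hz : 0 < z.im) :
    (stieltjes ρ z).im < 0 := by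
  rw [im_stieltjes hρ hz, neg_lt_zero]
  have hρ0 : 0 ≤ᵐ[volume] ρ := hb.mono fun x hx => hx.1
  rw [integral_pos_iff_support_of_nonneg_ae hρ0 hρ] at hpos
  have hi := integrable_halfPlaneKernel_mul hρ hz
  rw [integral_pos_iff_support_of_nonneg_ae
    (hρ0.mono fun x hx => mul_nonneg (halfPlaneKernel_pos hz x).le hx) hi]
  convert hpos using 2
  ext x
  simp [(halfPlaneKernel_pos hz x).ne']

/-- Quantitative lower bound for the imaginary part, coming from `ρ ≤ 1` and finite mass. -/
lemma neg_pi_add_le_im_stieltjes {L : ℝ} (hL : 0 < L) (hLρ : ∫ x, ρ x ≤ L) {z : ℂ}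
    (hz : 0 < z.im) :
    -Real.pi + L * (z.im / (L ^ 2 + z.im ^ 2)) ≤ (stieltjes ρ z).im := by
  have hK := integrable_halfPlaneKernel hz
  have hi := integrable_halfPlaneKernel_mul hρ hz
  set c := z.im / (L ^ 2 + z.im ^ 2) with hc
  have hc0 : 0 < c := by positivity
  set S := Icc (z.re - L) (z.re + L)
  have h1S : Integrable (fun _ : ℝ => (1 : ℝ)) (volume.restrict S) :=
    integrableOn_const measure_Icc_lt_top.ne
  have hSint : IntegrableOn (fun x => 1 - ρ x) S := by
    exact h1S.sub hρ.integrableOn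
  have h1 : L ≤ ∫ x in S, (1 - ρ x) := by
    rw [integral_sub h1S hρ.integrableOn]
    have : ∫ x in S, ρ x ≤ ∫ x, ρ x := setIntegral_le_integral hρ (hb.mono fun x hx => hx.1)
    have h2 : ∫ x in S, (1 : ℝ) = 2 * L := by
      simp [S, hL.le]; ring
    linarith
  have h3 : c * L ≤ ∫ x, halfPlaneKernel z x * (1 - ρ x) := by
    have hi' : Integrable fun x => halfPlaneKernel z x * (1 - ρ x) := by
      simp_rw [mul_sub, mul_one]; exact hK.sub hi
    calc c * L ≤ c * ∫ x in S, (1 - ρ x) := by gcongr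
      _ = ∫ x in S, c * (1 - ρ x) := (integral_const_mul _ _).symm
      _ ≤ ∫ x in S, halfPlaneKernel z x * (1 - ρ x) := by
        refine setIntegral_mono_on_ae (hSint.const_mul c) hi'.integrableOn measurableSet_Icc ?_
        filter_upwards [hb] with x hx hxS
        refine mul_le_mul_of_nonneg_right ?_ (by linarith [hx.2])
        rw [hc, halfPlaneKernel]
        have : (x - z.re) ^ 2 ≤ L ^ 2 := by
          apply sq_le_sq'
          · linarith [hxS.1]
          · linarith [hxS.2]
        gcongr
      _ ≤ _ := setIntegral_le_integral hi' (hb.mono fun x hx =>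
        mul_nonneg (halfPlaneKernel_pos hz x).le (by linarith [hx.2]))
  simp_rw [mul_sub, mul_one] at h3
  rw [integral_sub hK hi, integral_halfPlaneKernel hz] at h3
  rw [im_stieltjes hρ hz]
  linarith

end Stieltjes

section Poisson

/-- Cauchy's theorem on the upper half-plane for functions decaying quadratically. -/
lemma integral_eq_zero_of_differentiableOn_upperHalfPlane {G : ℂ → ℂ}
    (hc : ContinuousOn G {z | 0 ≤ z.im}) (hd : DifferentiableOn ℂ G {z | 0 < z.im})
    {C R₀ : ℝ} (hdecay : ∀ z : ℂ, 0 ≤ z.im → R₀ ≤ ‖z‖ → ‖G z‖ ≤ C / ‖z‖ ^ 2)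
    (hC : 0 ≤ C) (hint : Integrable fun x : ℝ => G x) : ∫ x : ℝ, G x = 0 := by
  have hlim := intervalIntegral_tendsto_integral hint tendsto_neg_atTop_atBot tendsto_id
  have hzero : Tendsto (fun R : ℝ => 4 * C * R⁻¹) atTop (𝓝 0) := by
    simpa using tendsto_inv_atTop_zero.const_mul (4 * C)
  refine tendsto_nhds_unique hlim (squeeze_zero_norm' ?_ hzero)
  filter_upwards [eventually_ge_atTop R₀, eventually_gt_atTop 0] with R hR hR0
  have hbound : ∀ w : ℂ, 0 ≤ w.im → R ≤ ‖w‖ → ‖G w‖ ≤ C / R ^ 2 := by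
    intro w hw hRw
    refine (hdecay w hw (hR.trans hRw)).trans ?_
    gcongr
  have hrect := Complex.integral_boundary_rect_eq_zero_of_continuousOn_of_differentiableOn G
    (⟨-R, 0⟩ : ℂ) (⟨R, R⟩ : ℂ) ?_ ?_
  · simp only [Complex.ofReal_zero, zero_mul, add_zero, smul_eq_mul] at hrect
    have hle : -R ≤ R := by linarith
    have h1 : ‖∫ x : ℝ in (-R)..R, G (x + R * Complex.I)‖ ≤ C / R ^ 2 * |R - -R| := by
      refine intervalIntegral.norm_integral_le_of_norm_le_const fun x _ => hbound _ ?_ ?_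
      · simpa using hR0.le
      · have := (le_abs_self _).trans (Complex.abs_im_le_norm (x + R * Complex.I))
        simpa using this
    have h2 : ‖∫ y : ℝ in (0 : ℝ)..R, G (R + y * Complex.I)‖ ≤ C / R ^ 2 * |R - 0| := by
      refine intervalIntegral.norm_integral_le_of_norm_le_const fun y hy => hbound _ ?_ ?_
      · rw [uIoc_of_le hR0.le] at hy
        simpa using hy.1.le
      · have := (le_abs_self _).trans (Complex.abs_re_le_norm (R + y * Complex.I))
        simpa using this
    have h3 : ‖∫ y : ℝ in (0 : ℝ)..R, G ((-R : ℝ) + y * Complex.I)‖ ≤ C / R ^ 2 * |R - 0| := by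
      refine intervalIntegral.norm_integral_le_of_norm_le_const fun y hy => hbound _ ?_ ?_
      · rw [uIoc_of_le hR0.le] at hy
        simpa using hy.1.le
      · have := (neg_le_abs _).trans (Complex.abs_re_le_norm ((-R : ℝ) + y * Complex.I))
        simpa using this
    have e : ∫ x : ℝ in (-R)..R, G x = (∫ x : ℝ in (-R)..R, G (x + R * Complex.I)) -
        Complex.I * (∫ y : ℝ in (0 : ℝ)..R, G (R + y * Complex.I)) +
        Complex.I * (∫ y : ℝ in (0 : ℝ)..R, G ((-R : ℝ) + y * Complex.I)) := by
      linear_combination hrect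
    rw [id, e]
    refine (norm_add_le _ _).trans ((add_le_add_left (norm_sub_le _ _) _).trans ?_)
    rw [norm_mul, norm_mul, Complex.norm_I, one_mul, one_mul]
    have e2 : 4 * C * R⁻¹ = C / R ^ 2 * |R - -R| + C / R ^ 2 * |R - 0| + C / R ^ 2 * |R - 0| := by
      rw [sub_neg_eq_add, sub_zero, abs_of_pos hR0, abs_of_pos (by linarith)]
      field_simp
      ring
    rw [e2]
    gcongr
  · refine hc.mono fun w hw => ?_
    have := hw.2
    simp only [uIcc_of_le hR0.le] at this
    exact this.1
  · refine hd.mono fun w hw => ?_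
    have := hw.2
    simp only [min_eq_left hR0.le] at this
    exact this.1

/-- Poisson formula for a bounded holomorphic function on the upper half-plane. -/
lemma integral_halfPlaneKernel_mul {h : ℂ → ℂ}
    (hc : ContinuousOn h {z | 0 ≤ z.im}) (hd : DifferentiableOn ℂ h {z | 0 < z.im})
    {B : ℝ} (hB : ∀ z : ℂ, 0 ≤ z.im → ‖h z‖ ≤ B) {z : ℂ} (hz : 0 < z.im) :
    ∫ x : ℝ, (halfPlaneKernel z x : ℂ) * h x = Real.pi * h z := by
  have hB0 : 0 ≤ B := (norm_nonneg _).trans (hB z hz.le)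
  have hnhds : {z : ℂ | 0 < z.im} ∈ 𝓝 z :=
    (isOpen_lt continuous_const Complex.continuous_im).mem_nhds hz
  have hnhds' : {z : ℂ | 0 ≤ z.im} ∈ 𝓝 z := mem_of_superset hnhds fun w (hw : 0 < w.im) => hw.le
  have hsub : ∀ w : ℂ, 0 ≤ w.im → w - conj z ≠ 0 := by
    intro w hw h0
    have := congrArg Complex.im h0
    simp at this
    linarith
  set G : ℂ → ℂ := fun w => z.im * (dslope h z w / (w - conj z)) with hG
  have hGc : ContinuousOn G {z | 0 ≤ z.im} := by
    refine continuousOn_const.mul (ContinuousOn.div ?_ (by fun_prop) hsub)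
    exact (continuousOn_dslope hnhds').2 ⟨hc, hd.differentiableAt hnhds⟩
  have hGd : DifferentiableOn ℂ G {z | 0 < z.im} := by
    refine DifferentiableOn.const_mul (DifferentiableOn.div ?_ (by fun_prop) fun w hw =>
      hsub w (le_of_lt hw)) _
    exact (Complex.differentiableOn_dslope hnhds).2 hd
  have hGx : ∀ x : ℝ, G x = (halfPlaneKernel z x : ℂ) * (h x - h z) := by
    intro x
    have hne : (x : ℂ) ≠ z := fun h0 => by simp [← h0] at hz
    have h1 : (x : ℂ) - z ≠ 0 := sub_ne_zero.2 hne
    have h2 := hsub x (by simp)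
    have h3 : ((x : ℂ) - z) * (x - conj z) = (((x - z.re) ^ 2 + z.im ^ 2 : ℝ) : ℂ) := by
      apply Complex.ext
      · simp [pow_two]
      · simp [pow_two]; ring
    have h4 : (((x - z.re) ^ 2 + z.im ^ 2 : ℝ) : ℂ) ≠ 0 := h3 ▸ mul_ne_zero h1 h2
    simp only [hG, dslope_of_ne _ hne, slope_def_field]
    rw [div_div, h3, halfPlaneKernel, Complex.ofReal_div]
    ring
  have hK := integrable_halfPlaneKernel hz
  have hKh : Integrable fun x : ℝ => (halfPlaneKernel z x : ℂ) * h x := by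
    refine hK.ofReal.mul_bdd (c := B) ?_ (Eventually.of_forall fun x => hB x (by simp))
    refine Continuous.aestronglyMeasurable ?_
    exact hc.comp_continuous Complex.continuous_ofReal fun x => by simp
  have hKz : Integrable fun x : ℝ => (halfPlaneKernel z x : ℂ) * h z := hK.ofReal.mul_const _
  have hGint : Integrable fun x : ℝ => G x := by
    simp_rw [hGx, mul_sub]
    exact hKh.sub hKz
  have hmain := integral_eq_zero_of_differentiableOn_upperHalfPlane hGc hGd
    (C := 8 * z.im * B) (R₀ := 2 * ‖z‖) ?_ (by positivity) hGint
  · simp_rw [hGx, mul_sub] at hmain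
    rw [integral_sub hKh hKz, integral_mul_const, integral_complex_ofReal,
      integral_halfPlaneKernel hz, sub_eq_zero] at hmain
    exact hmain
  · intro w hw hRw
    have hz0 : 0 < ‖z‖ := norm_pos_iff.2 fun h0 => by simp [h0] at hz
    have h1 : ‖w‖ / 2 ≤ ‖w - z‖ := by
      have := norm_sub_norm_le w z
      linarith
    have h2 : ‖w‖ / 2 ≤ ‖w - conj z‖ := by
      have := norm_sub_norm_le w (conj z)
      rw [RCLike.norm_conj] at this
      linarith
    have hne : w ≠ z := fun h0 => by rw [h0] at hRw; linarith
    have h3 : ‖h w - h z‖ ≤ 2 * B := by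
      have := norm_sub_le (h w) (h z)
      linarith [hB w hw, hB z hz.le]
    have hw0 : 0 < ‖w‖ := by linarith
    simp only [hG, dslope_of_ne _ hne, slope_def_field, norm_mul, norm_div, Complex.norm_real,
      Real.norm_eq_abs, abs_of_pos hz]
    calc z.im * (‖h w - h z‖ / ‖w - z‖ / ‖w - conj z‖)
        ≤ z.im * (2 * B / (‖w‖ / 2) / (‖w‖ / 2)) := by gcongr
      _ = 8 * z.im * B / ‖w‖ ^ 2 := by field_simp; ring

lemma integral_halfPlaneKernel_mul_im {h : ℂ → ℂ}
    (hc : ContinuousOn h {z | 0 ≤ z.im}) (hd : DifferentiableOn ℂ h {z | 0 < z.im})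
    {B : ℝ} (hB : ∀ z : ℂ, 0 ≤ z.im → ‖h z‖ ≤ B) {z : ℂ} (hz : 0 < z.im) :
    ∫ x : ℝ, halfPlaneKernel z x * (h x).im = Real.pi * (h z).im := by
  have hKh : Integrable fun x : ℝ => (halfPlaneKernel z x : ℂ) * h x := by
    refine (integrable_halfPlaneKernel hz).ofReal.mul_bdd (c := B) ?_
      (Eventually.of_forall fun x => hB x (by simp))
    refine Continuous.aestronglyMeasurable ?_
    exact hc.comp_continuous Complex.continuous_ofReal fun x => by simp
  have h1 := integral_im hKh
  rw [integral_halfPlaneKernel_mul hc hd hB hz] at h1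
  simpa using h1

end Poisson

section Representation

/-- A density bounded by one whose Poisson integral decays like `M / y` along the imaginary axis
is integrable. -/
lemma integrable_of_integral_halfPlaneKernel_mul_le {f : ℝ → ℝ} (hf : AEStronglyMeasurable f)
    (hb : ∀ᵐ x, f x ∈ Icc (0 : ℝ) 1) {M : ℝ}
    (hM : ∀ y : ℝ, 0 < y → ∫ x, halfPlaneKernel (y * Complex.I) x * f x ≤ M / y) :
    Integrable f ∧ ∫ x, f x ≤ M := by
  have hf0 : ∀ᵐ x, 0 ≤ f x := hb.mono fun x hx => hx.1
  have hloc : ∀ R : ℝ, IntegrableOn f (Icc (-R) R) := fun R => by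
    refine Measure.integrableOn_of_bounded (M := 1) measure_Icc_lt_top.ne hf
      (ae_restrict_of_ae (hb.mono fun x hx => ?_))
    rw [Real.norm_eq_abs, abs_of_nonneg hx.1]
    exact hx.2
  have hbound : ∀ R : ℝ, ∫ x in Icc (-R) R, f x ≤ M := by
    intro R
    have hlim : Tendsto (fun y : ℝ => M * (R ^ 2 * (y⁻¹) ^ 2 + 1)) atTop
        (𝓝 (M * (R ^ 2 * 0 ^ 2 + 1))) :=
      (((tendsto_inv_atTop_zero.pow 2).const_mul _).add_const _).const_mul _
    simp only [ne_eq, OfNat.ofNat_ne_zero, not_false_eq_true, zero_pow, mul_zero, zero_add,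
      mul_one] at hlim
    refine ge_of_tendsto hlim ?_
    filter_upwards [eventually_gt_atTop 0] with y hy
    have hyI : 0 < (y * Complex.I).im := by simpa using hy
    have hKf : Integrable fun x => halfPlaneKernel (y * Complex.I) x * f x := by
      refine (integrable_halfPlaneKernel hyI).mul_bdd (c := 1) hf (hb.mono fun x hx => ?_)
      rw [Real.norm_eq_abs, abs_of_nonneg hx.1]
      exact hx.2
    have h1 : ∫ x in Icc (-R) R, y / (R ^ 2 + y ^ 2) * f x ≤ M / y := by
      refine le_trans ?_ (hM y hy)
      refine le_trans (setIntegral_mono_on_ae ((hloc R).const_mul _) hKf.integrableOn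
        measurableSet_Icc ?_) (setIntegral_le_integral hKf
          (hf0.mono fun x hx => mul_nonneg (halfPlaneKernel_pos hyI x).le hx))
      filter_upwards [hf0] with x hx hxR
      refine mul_le_mul_of_nonneg_right ?_ hx
      simp only [halfPlaneKernel, Complex.mul_im, Complex.ofReal_re, Complex.I_im, mul_one,
        Complex.ofReal_im, Complex.I_re, mul_zero, add_zero, Complex.mul_re, sub_zero]
      have : x ^ 2 ≤ R ^ 2 := sq_le_sq' hxR.1 hxR.2
      gcongr
    rw [integral_const_mul] at h1
    have h2 : 0 < R ^ 2 + y ^ 2 := by positivity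
    rw [div_mul_eq_mul_div, div_le_div_iff₀ h2 hy] at h1
    have e : M * (R ^ 2 * (y⁻¹) ^ 2 + 1) = M * (R ^ 2 + y ^ 2) / (y * y) := by
      field_simp
    rw [e, le_div_iff₀ (by positivity)]
    linarith
  have hcover : AECover (volume : Measure ℝ) atTop fun R : ℝ => Icc (-R) R :=
    aecover_Icc tendsto_neg_atTop_atBot tendsto_id
  have hint := hcover.integrable_of_integral_bounded_of_nonneg_ae M hloc hf0
    (Eventually.of_forall hbound)
  exact ⟨hint, le_of_tendsto (hcover.integral_tendsto_of_countably_generated hint)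
    (Eventually.of_forall hbound)⟩

/-- Weak compactness of balls in a Hilbert space. -/
lemma exists_weak_limit {E : Type*} [NormedAddCommGroup E] [InnerProductSpace ℝ E]
    [CompleteSpace E] (u : ℕ → E) {r : ℝ} (hu : ∀ n, ‖u n‖ ≤ r) :
    ∃ w : E, ∃ F : Ultrafilter ℕ, ↑F ≤ (atTop : Filter ℕ) ∧
      ∀ φ : E, Tendsto (fun n => inner ℝ (u n) φ) F (𝓝 (inner ℝ w φ)) := by
  set F : Ultrafilter ℕ := Ultrafilter.of atTop
  set T : ℕ → WeakDual ℝ E := fun n => StrongDual.toWeakDual (InnerProductSpace.toDual ℝ E (u n))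
  have hT : ∀ n, T n ∈ WeakDual.toStrongDual ⁻¹' Metric.closedBall (0 : StrongDual ℝ E) r := by
    intro n
    have : ‖InnerProductSpace.toDual ℝ E (u n)‖ ≤ r := by simpa using hu n
    simpa [T] using this
  obtain ⟨ℓ, -, hℓ⟩ := (WeakDual.isCompact_closedBall (𝕜 := ℝ) (0 : StrongDual ℝ E) r)
    |>.ultrafilter_le_nhds (F.map T) (le_principal_iff.2
      (Ultrafilter.mem_coe.2 (Ultrafilter.mem_map.2 (Eventually.of_forall hT))))
  refine ⟨(InnerProductSpace.toDual ℝ E).symm (WeakDual.toStrongDual ℓ), F,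
    Ultrafilter.of_le atTop, fun φ => ?_⟩
  rw [InnerProductSpace.toDual_symm_apply]
  exact ((WeakDual.eval_continuous φ).tendsto ℓ).comp (show Tendsto T F (𝓝 ℓ) from hℓ)

/-- Weak sequential compactness of densities bounded by one, tested against `L²`. -/
lemma exists_weak_limit_density {f : ℕ → ℝ → ℝ} (hf : ∀ n, Integrable (f n))
    (hb : ∀ n, ∀ᵐ x, f n x ∈ Icc (0 : ℝ) 1) {M : ℝ} (hM : ∀ n, ∫ x, f n x ≤ M) :
    ∃ ρ : ℝ → ℝ, Measurable ρ ∧ (∀ᵐ x, ρ x ∈ Icc (0 : ℝ) 1) ∧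
      ∃ F : Ultrafilter ℕ, ↑F ≤ (atTop : Filter ℕ) ∧
        ∀ φ : ℝ → ℝ, MemLp φ 2 → Tendsto (fun n => ∫ x, φ x * f n x) F (𝓝 (∫ x, φ x * ρ x)) := by
  have hsq : ∀ n, Integrable fun x => f n x ^ 2 := fun n => by
    refine (hf n).mono' ((hf n).aestronglyMeasurable.pow 2) ((hb n).mono fun x hx => ?_)
    rw [Real.norm_eq_abs, abs_of_nonneg (sq_nonneg _)]
    nlinarith [hx.1, hx.2]
  have hmem : ∀ n, MemLp (f n) 2 := fun n =>
    (memLp_two_iff_integrable_sq (hf n).aestronglyMeasurable).2 (hsq n)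
  have hinner : ∀ n (φ : Lp ℝ 2 (volume : Measure ℝ)),
      inner ℝ ((hmem n).toLp (f n)) φ = ∫ x, φ x * f n x := by
    intro n φ
    rw [L2.inner_def]
    refine integral_congr_ae ((hmem n).coeFn_toLp.mono fun x hx => ?_)
    simp [hx]
  have hnorm : ∀ n, ‖(hmem n).toLp (f n)‖ ≤ Real.sqrt M := by
    intro n
    refine Real.le_sqrt_of_sq_le ?_
    rw [← real_inner_self_eq_norm_sq, hinner]
    refine le_trans (integral_mono_ae ?_ (hf n) ?_) (hM n)
    · refine (hsq n).congr ((hmem n).coeFn_toLp.mono fun x hx => ?_)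
      simp [hx, sq]
    · filter_upwards [(hmem n).coeFn_toLp, hb n] with x hx hx1
      rw [hx]
      nlinarith [hx1.1, hx1.2]
  obtain ⟨w, F, hF, hw⟩ := exists_weak_limit (fun n => (hmem n).toLp (f n)) hnorm
  have htest : ∀ φ : ℝ → ℝ, MemLp φ 2 →
      Tendsto (fun n => ∫ x, φ x * f n x) F (𝓝 (∫ x, φ x * w x)) := by
    intro φ hφ
    have h1 := hw (hφ.toLp φ)
    simp only [hinner] at h1
    have e1 : ∀ n, ∫ x, hφ.toLp φ x * f n x = ∫ x, φ x * f n x := fun n =>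
      integral_congr_ae (hφ.coeFn_toLp.mono fun x hx => by simp [hx])
    have e2 : inner ℝ w (hφ.toLp φ) = ∫ x, φ x * w x := by
      rw [L2.inner_def]
      exact integral_congr_ae (hφ.coeFn_toLp.mono fun x hx => by simp [hx])
    simpa only [e1, e2] using h1
  have hset : ∀ s : Set ℝ, MeasurableSet s → volume s < ⊤ →
      Tendsto (fun n => ∫ x in s, f n x) F (𝓝 (∫ x in s, w x)) := by
    intro s hs hμ
    have hφ : MemLp (s.indicator fun _ => (1 : ℝ)) 2 (volume : Measure ℝ) :=
      memLp_indicator_const 2 hs 1 (Or.inr hμ.ne)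
    have e : ∀ g : ℝ → ℝ, ∫ x, s.indicator (fun _ => (1 : ℝ)) x * g x = ∫ x in s, g x := by
      intro g
      rw [← integral_indicator hs]
      congr 1
      ext x
      by_cases hx : x ∈ s <;> simp [hx]
    simpa only [e] using htest _ hφ
  have hwint : ∀ s : Set ℝ, MeasurableSet s → volume s < ⊤ → IntegrableOn w s := by
    intro s hs hμ
    have : IsFiniteMeasure (volume.restrict s) := ⟨by simpa using hμ⟩
    exact ((Lp.memLp w).restrict s).integrable (by norm_num)
  have h0 : 0 ≤ᵐ[volume] (w : ℝ → ℝ) := by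
    refine ae_nonneg_of_forall_setIntegral_nonneg_of_sigmaFinite hwint fun s hs hμ => ?_
    refine ge_of_tendsto (hset s hs hμ) (Eventually.of_forall fun n => ?_)
    exact setIntegral_nonneg_of_ae_restrict (ae_restrict_of_ae ((hb n).mono fun x hx => hx.1))
  have h1 : 0 ≤ᵐ[volume] fun x => 1 - w x := by
    have hone : ∀ s : Set ℝ, volume s < ⊤ → IntegrableOn (fun _ : ℝ => (1 : ℝ)) s := fun s hμ =>
      integrableOn_const hμ.ne
    refine ae_nonneg_of_forall_setIntegral_nonneg_of_sigmaFinite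
      (fun s hs hμ => (hone s hμ).sub (hwint s hs hμ)) fun s hs hμ => ?_
    rw [integral_sub (hone s hμ) (hwint s hs hμ), sub_nonneg]
    refine le_of_tendsto (hset s hs hμ) (Eventually.of_forall fun n => ?_)
    exact integral_mono_ae (hf n).integrableOn (hone s hμ)
      (ae_restrict_of_ae ((hb n).mono fun x hx => hx.2))
  refine ⟨w, (Lp.stronglyMeasurable w).measurable, ?_, F, hF, htest⟩
  filter_upwards [h0, h1] with x hx0 hx1
  exact ⟨hx0, by simpa using hx1⟩

/-- A holomorphic function on the upper half-plane with imaginary part in `[-π, 0]` and decaying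
like `M / Im z` is the Stieltjes transform of a density with values in `[0, 1]`. -/
lemma exists_stieltjes_eq {h : ℂ → ℂ} (hd : DifferentiableOn ℂ h {z | 0 < z.im})
    (him : ∀ z : ℂ, 0 < z.im → (h z).im ∈ Icc (-Real.pi) 0) {M : ℝ}
    (hM : ∀ z : ℂ, 0 < z.im → ‖h z‖ ≤ M / z.im) :
    ∃ ρ : ℝ → ℝ, Measurable ρ ∧ (∀ᵐ x, ρ x ∈ Icc (0 : ℝ) 1) ∧ Integrable ρ ∧
      ∀ z : ℂ, 0 < z.im → stieltjes ρ z = h z := by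
  have hM0 : 0 ≤ M := by
    have := (norm_nonneg _).trans (hM Complex.I (by simp))
    simpa using this
  set ε : ℕ → ℝ := fun n => 1 / ((n : ℝ) + 1) with hε
  have hεpos : ∀ n, 0 < ε n := fun n => by positivity
  set s : ℕ → ℂ → ℂ := fun n z => z + ε n * Complex.I with hs
  have hsim : ∀ n z, (s n z).im = z.im + ε n := fun n z => by simp [hs]
  set f : ℕ → ℝ → ℝ := fun n x => -(h (s n x)).im / Real.pi with hf
  have hsc : ∀ n, ContinuousOn (fun z => h (s n z)) {z | 0 ≤ z.im} := fun n => by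
    refine hd.continuousOn.comp (by fun_prop) fun z hz => ?_
    have hz' : 0 ≤ z.im := hz
    have := hεpos n
    show 0 < (s n z).im
    rw [hsim]
    linarith
  have hsd : ∀ n, DifferentiableOn ℂ (fun z => h (s n z)) {z | 0 < z.im} := fun n => by
    refine hd.comp (by fun_prop) fun z hz => ?_
    have hz' : 0 < z.im := hz
    have := hεpos n
    show 0 < (s n z).im
    rw [hsim]
    linarith
  have hsB : ∀ n, ∀ z : ℂ, 0 ≤ z.im → ‖h (s n z)‖ ≤ M / ε n := fun n z hz => by
    have := hεpos n
    refine (hM _ (by rw [hsim]; linarith)).trans ?_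
    rw [hsim]
    gcongr
    linarith
  have hfb : ∀ n x, f n x ∈ Icc (0 : ℝ) 1 := fun n x => by
    have := him (s n x) (by rw [hsim]; simpa using hεpos n)
    refine ⟨div_nonneg (by linarith [this.2]) Real.pi_pos.le, ?_⟩
    rw [hf]
    simp only
    rw [div_le_one Real.pi_pos]
    linarith [this.1]
  have hfc : ∀ n, Continuous (f n) := fun n => by
    have : Continuous fun x : ℝ => h (s n x) :=
      (hsc n).comp_continuous Complex.continuous_ofReal fun x => by simp
    exact (Complex.continuous_im.comp this).neg.div_const _
  have hKf : ∀ n, ∀ z : ℂ, 0 < z.im → ∫ x, halfPlaneKernel z x * f n x = -(h (s n z)).im := by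
    intro n z hz
    have e : ∀ x : ℝ, halfPlaneKernel z x * f n x =
        -(Real.pi)⁻¹ * (halfPlaneKernel z x * (h (s n x)).im) := fun x => by
      rw [hf]; ring
    simp_rw [e]
    rw [integral_const_mul, integral_halfPlaneKernel_mul_im (hsc n) (hsd n) (hsB n) hz]
    field_simp [Real.pi_ne_zero]
  have hdecay : ∀ z : ℂ, 0 < z.im → ∀ y : ℝ, 0 < y → y ≤ z.im → -(h z).im ≤ M / y := by
    intro z hz y hy hyz
    refine (neg_le_abs _).trans ((Complex.abs_im_le_norm _).trans ((hM z hz).trans ?_))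
    gcongr
  have hfint : ∀ n, Integrable (f n) ∧ ∫ x, f n x ≤ M := fun n => by
    refine integrable_of_integral_halfPlaneKernel_mul_le (hfc n).aestronglyMeasurable
      (Eventually.of_forall (hfb n)) fun y hy => ?_
    rw [hKf n _ (by simpa using hy)]
    have := hεpos n
    refine hdecay _ ?_ y hy ?_
    · rw [hsim]; simp; linarith
    · rw [hsim]; simp; linarith
  obtain ⟨ρ, hρm, hρb, F, hF, hlim⟩ := exists_weak_limit_density (fun n => (hfint n).1)
    (fun n => Eventually.of_forall (hfb n)) (fun n => (hfint n).2)
  have hopen : IsOpen {z : ℂ | 0 < z.im} := isOpen_lt continuous_const Complex.continuous_im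
  have hKρ : ∀ z : ℂ, 0 < z.im → ∫ x, halfPlaneKernel z x * ρ x = -(h z).im := by
    intro z hz
    refine tendsto_nhds_unique (hlim _ (memLp_halfPlaneKernel hz)) ?_
    simp_rw [hKf _ z hz]
    have hsz : Tendsto (fun n => s n z) atTop (𝓝 z) := by
      have h1 : Tendsto ε atTop (𝓝 0) := tendsto_one_div_add_atTop_nhds_zero_nat
      have h2 := (((Complex.continuous_ofReal.tendsto 0).comp h1).mul_const Complex.I).const_add z
      simpa using h2
    have hcz : ContinuousAt h z := hd.continuousOn.continuousAt (hopen.mem_nhds hz)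
    exact (((Complex.continuous_im.tendsto _).comp (hcz.tendsto.comp hsz)).neg).mono_left hF
  have hρint := (integrable_of_integral_halfPlaneKernel_mul_le hρm.aestronglyMeasurable hρb
    (M := M) fun y hy => by
      rw [hKρ _ (by simpa using hy)]
      exact hdecay _ (by simpa using hy) y hy (by simp)).1
  refine ⟨ρ, hρm, hρb, hρint, ?_⟩
  have hconn : IsConnected {z : ℂ | 0 < z.im} :=
    (convex_halfSpace_im_gt 0).isConnected ⟨Complex.I, by simp⟩
  obtain ⟨c, hc⟩ := AnalyticOnNhd.eq_const_of_im_eq_const (c₀ := 0)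
    (((differentiableOn_stieltjes hρint).sub hd).analyticOnNhd hopen) (fun z hz => by
      simp only [Pi.sub_apply, Complex.sub_im]
      rw [im_stieltjes hρint hz, hKρ z hz]
      ring) hopen hconn
  have hc0 : c = 0 := by
    set A := (∫ x, ‖ρ x‖) + M
    have hzero : Tendsto (fun y : ℝ => A * y⁻¹) atTop (𝓝 0) := by
      simpa using tendsto_inv_atTop_zero.const_mul A
    have hcle : ‖c‖ ≤ 0 := by
      refine ge_of_tendsto hzero ?_
      filter_upwards [eventually_gt_atTop 0] with y hy
      have hy' : 0 < ((y : ℂ) * Complex.I).im := by simpa using hy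
      rw [← hc _ hy']
      refine (norm_sub_le _ _).trans ?_
      refine (add_le_add (norm_stieltjes_le hρint hy') (hM _ hy')).trans_eq ?_
      simp [A]
      ring
    simpa using hcle
  intro z hz
  have := hc z hz
  rw [hc0] at this
  exact sub_eq_zero.1 this

end Representation
section Pick

lemma sub_conj_ne_zero {a b : ℂ} (ha : 0 < a.im) (hb : 0 < b.im) : a - conj b ≠ 0 := by
  intro h
  have := congrArg Complex.im h
  simp at this
  linarith

lemma normSq_sub_conj (a b : ℂ) :
    ‖a - conj b‖ ^ 2 = ‖a - b‖ ^ 2 + 4 * a.im * b.im := by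
  simp only [← Complex.normSq_eq_norm_sq, Complex.normSq_apply]
  simp
  ring

lemma norm_sub_lt_norm_sub_conj {a b : ℂ} (ha : 0 < a.im) (hb : 0 < b.im) :
    ‖a - b‖ < ‖a - conj b‖ := by
  have := normSq_sub_conj a b
  have : 0 < a.im * b.im := mul_pos ha hb
  exact lt_of_pow_lt_pow_left₀ 2 (norm_nonneg _) (by linarith)

/-- Schwarz–Pick lemma for the upper half-plane, in Cayley coordinates. -/
lemma norm_sub_mul_norm_sub_conj_le {v : ℂ → ℂ} (hd : DifferentiableOn ℂ v {z | 0 < z.im})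
    (hv : ∀ z : ℂ, 0 < z.im → 0 < (v z).im) {a b : ℂ} (ha : 0 < a.im) (hb : 0 < b.im) :
    ‖v a - v b‖ * ‖a - conj b‖ ≤ ‖a - b‖ * ‖v a - conj (v b)‖ := by
  set φ : ℂ → ℂ := fun u => (b - conj b * u) / (1 - u) with hφ
  have hφne : ∀ u ∈ Metric.ball (0 : ℂ) 1, 1 - u ≠ 0 := by
    intro u hu h
    rw [sub_eq_zero] at h
    simp [← h] at hu
  have hφim : ∀ u ∈ Metric.ball (0 : ℂ) 1, 0 < (φ u).im := by
    intro u hu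
    have hne := hφne u hu
    have hu' : ‖u‖ ^ 2 < 1 := by
      have : ‖u‖ < 1 := by simpa using hu
      have h0 := norm_nonneg u
      nlinarith
    have hpos : 0 < Complex.normSq (1 - u) := Complex.normSq_pos.2 hne
    have : (φ u).im = b.im * (1 - ‖u‖ ^ 2) / Complex.normSq (1 - u) := by
      rw [eq_div_iff hpos.ne', hφ, Complex.div_im]
      field_simp
      simp [← Complex.normSq_eq_norm_sq, Complex.normSq_apply]
      ring
    rw [this]
    have : 0 < 1 - ‖u‖ ^ 2 := by linarith
    positivity
  have hφd : DifferentiableOn ℂ φ (Metric.ball 0 1) := by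
    refine DifferentiableOn.div (by fun_prop) (by fun_prop) hφne
  set Ψ : ℂ → ℂ := fun u => (v (φ u) - v b) / (v (φ u) - conj (v b)) with hΨ
  have hvφ : DifferentiableOn ℂ (fun u => v (φ u)) (Metric.ball 0 1) := hd.comp hφd hφim
  have hΨd : DifferentiableOn ℂ Ψ (Metric.ball 0 1) := by
    refine DifferentiableOn.div (hvφ.sub_const _) (hvφ.sub_const _) fun u hu => ?_
    exact sub_conj_ne_zero (hv _ (hφim u hu)) (hv _ hb)
  have hmaps : MapsTo Ψ (Metric.ball 0 1) (Metric.closedBall 0 1) := by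
    intro u hu
    have h1 := hv _ (hφim u hu)
    rw [mem_closedBall_zero_iff, hΨ, norm_div, div_le_one (norm_pos_iff.2
      (sub_conj_ne_zero h1 (hv _ hb)))]
    exact (norm_sub_lt_norm_sub_conj h1 (hv _ hb)).le
  have hΨ0 : Ψ 0 = 0 := by simp [hΨ, hφ]
  have hne := sub_conj_ne_zero ha hb
  have hne' := norm_pos_iff.2 hne
  have hnb : b - conj b ≠ 0 := sub_conj_ne_zero hb hb
  set u := (a - b) / (a - conj b) with hu
  have hu1 : ‖u‖ < 1 := by
    rw [hu, norm_div, div_lt_one hne']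
    exact norm_sub_lt_norm_sub_conj ha hb
  have hφu : φ u = a := by
    have h1 := hφne u (by simpa using hu1)
    rw [hφ]
    simp only
    rw [div_eq_iff h1, hu]
    field_simp
    ring
  have key := Complex.norm_le_norm_of_mapsTo_ball hΨd hmaps hΨ0 hu1
  rw [hΨ] at key
  simp only [hφu] at key
  rw [hu, norm_div, norm_div, div_le_div_iff₀ (norm_pos_iff.2
    (sub_conj_ne_zero (hv a ha) (hv b hb))) hne'] at key
  exact key

/-- Schwarz–Pick lemma for the upper half-plane. -/
lemma schwarz_pick {v : ℂ → ℂ} (hd : DifferentiableOn ℂ v {z | 0 < z.im})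
    (hv : ∀ z : ℂ, 0 < z.im → 0 < (v z).im) {a b : ℂ} (ha : 0 < a.im) (hb : 0 < b.im) :
    ‖v a - v b‖ ^ 2 * (a.im * b.im) ≤ ‖a - b‖ ^ 2 * ((v a).im * (v b).im) := by
  have h := norm_sub_mul_norm_sub_conj_le hd hv ha hb
  have h2 := pow_le_pow_left₀ (by positivity) h 2
  rw [mul_pow, mul_pow, normSq_sub_conj, normSq_sub_conj] at h2
  nlinarith

/-- Infinitesimal Schwarz–Pick lemma for the upper half-plane. -/
lemma norm_deriv_mul_im_le {v : ℂ → ℂ} (hd : DifferentiableOn ℂ v {z | 0 < z.im})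
    (hv : ∀ z : ℂ, 0 < z.im → 0 < (v z).im) {a : ℂ} (ha : 0 < a.im) :
    ‖deriv v a‖ * a.im ≤ (v a).im := by
  have hopen : {z : ℂ | 0 < z.im} ∈ 𝓝 a :=
    (isOpen_lt continuous_const Complex.continuous_im).mem_nhds ha
  have hda := (hd.differentiableAt hopen)
  have hslope := hda.hasDerivAt.tendsto_slope
  have hL : Tendsto (fun z => ‖slope v a z‖ ^ 2 * (z.im * a.im)) (𝓝[≠] a)
      (𝓝 (‖deriv v a‖ ^ 2 * (a.im * a.im))) :=
    (hslope.norm.pow 2).mul (((Complex.continuous_im.tendsto a).mono_left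
      nhdsWithin_le_nhds).mul_const _)
  have hR : Tendsto (fun z => (v z).im * (v a).im) (𝓝[≠] a) (𝓝 ((v a).im * (v a).im)) :=
    (((Complex.continuous_im.tendsto _).comp hda.continuousAt.tendsto).mono_left
      nhdsWithin_le_nhds).mul_const _
  have hle := le_of_tendsto_of_tendsto hL hR ?_
  · refine le_of_sq_le_sq (by linarith) (hv a ha).le
  · filter_upwards [self_mem_nhdsWithin, nhdsWithin_le_nhds hopen] with z hz hz'
    have h := schwarz_pick hd hv hz' ha
    have hne : 0 < ‖z - a‖ := norm_pos_iff.2 (sub_ne_zero.2 hz)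
    rw [slope_def_field, norm_div, div_pow, div_mul_eq_mul_div, div_le_iff₀ (by positivity)]
    linarith

end Pick

section FixedPoint

variable {v : ℂ → ℂ} (hd : DifferentiableOn ℂ v {z | 0 < z.im})
  (hv : ∀ z : ℂ, 0 < z.im → 0 < (v z).im)

include hd hv

lemma strict_contraction {t : ℝ} (ht : 0 ≤ t) {z a b : ℂ} (hz : 0 < z.im)
    (ha : 0 < a.im) (hb : 0 < b.im) (hab : a ≠ b) :
    ‖(z + t * v a) - (z + t * v b)‖ ^ 2 * (a.im * b.im) <
      ‖a - b‖ ^ 2 * ((z + t * v a).im * (z + t * v b).im) := by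
  have h := mul_le_mul_of_nonneg_left (schwarz_pick hd hv ha hb) (sq_nonneg t)
  have hn : 0 < ‖a - b‖ ^ 2 := by
    have := norm_pos_iff.2 (sub_ne_zero.2 hab)
    positivity
  have hva := hv a ha
  have hvb := hv b hb
  have e : (z + t * v a) - (z + t * v b) = t * (v a - v b) := by ring
  rw [e, norm_mul, mul_pow, Complex.norm_real, Real.norm_eq_abs, sq_abs]
  have : ‖a - b‖ ^ 2 * (t ^ 2 * ((v a).im * (v b).im)) <
      ‖a - b‖ ^ 2 * ((z + t * v a).im * (z + t * v b).im) := by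
    refine mul_lt_mul_of_pos_left ?_ hn
    simp only [Complex.add_im, Complex.mul_im, Complex.ofReal_re, Complex.ofReal_im, zero_mul,
      add_zero]
    have h1 : 0 ≤ t * (v a).im := by positivity
    have h2 : 0 ≤ t * (v b).im := by positivity
    nlinarith [mul_pos hz hz, mul_nonneg h1 hz.le, mul_nonneg h2 hz.le]
  linarith

lemma fixedPoint_unique {t : ℝ} (ht : 0 ≤ t) {z a b : ℂ} (hz : 0 < z.im)
    (ha : 0 < a.im) (hb : 0 < b.im) (hfa : z + t * v a = a) (hfb : z + t * v b = b) : a = b := by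
  by_contra hab
  have h := strict_contraction hd hv ht hz ha hb hab
  rw [hfa, hfb] at h
  exact lt_irrefl _ h

lemma exists_fixedPoint {t : ℝ} (ht : 0 ≤ t) {z : ℂ} (hz : 0 < z.im) {C : ℝ}
    (hC : ∀ w : ℂ, z.im ≤ w.im → ‖v w‖ ≤ C) :
    ∃ a : ℂ, z.im ≤ a.im ∧ z + t * v a = a := by
  set g : ℂ → ℂ := fun a => z + t * v a with hg
  set K : Set ℂ := {w | z.im ≤ w.im} ∩ Metric.closedBall z (t * C) with hK
  have hKc : IsCompact K := (isCompact_closedBall _ _).inter_left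
    (isClosed_le continuous_const Complex.continuous_im)
  have hgK' : ∀ a : ℂ, z.im ≤ a.im → g a ∈ K := by
    intro a ha
    have h1 := hv a (hz.trans_le ha)
    refine ⟨?_, ?_⟩
    · simp only [hg, mem_ofPred_eq, Complex.add_im, Complex.mul_im, Complex.ofReal_re,
        Complex.ofReal_im, zero_mul, add_zero]
      nlinarith [mul_nonneg ht h1.le]
    · rw [mem_closedBall_iff_norm, hg]
      simp only [add_sub_cancel_left, norm_mul, Complex.norm_real, Real.norm_eq_abs,
        abs_of_nonneg ht]
      exact mul_le_mul_of_nonneg_left (hC a ha) ht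
  have hKpos : ∀ a ∈ K, 0 < a.im := fun a ha => hz.trans_le ha.1
  have hvc : ContinuousOn v K := hd.continuousOn.mono hKpos
  have hgc : ContinuousOn g K := continuousOn_const.add (continuousOn_const.mul hvc)
  have hcont : ContinuousOn (fun a => ‖g a - a‖ ^ 2 / ((g a).im * a.im)) K := by
    refine ContinuousOn.div (((hgc.sub continuousOn_id).norm).pow 2)
      ((Complex.continuous_im.comp_continuousOn hgc).mul Complex.continuous_im.continuousOn) ?_
    intro a ha
    exact (mul_pos (hKpos _ (hgK' a ha.1)) (hKpos a ha)).ne'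
  obtain ⟨a, haK, hmin⟩ := hKc.exists_isMinOn ⟨g z, hgK' z le_rfl⟩ hcont
  refine ⟨a, haK.1, ?_⟩
  by_contra hne
  have hga := hgK' a haK.1
  have hgga := hgK' _ hga.1
  have h := strict_contraction hd hv ht hz (hKpos _ hga) (hKpos _ haK) hne
  have hm : ‖g a - a‖ ^ 2 / ((g a).im * a.im) ≤ ‖g (g a) - g a‖ ^ 2 / ((g (g a)).im * (g a).im) :=
    hmin hga
  rw [div_le_div_iff₀ (mul_pos (hKpos _ hga) (hKpos _ haK))
    (mul_pos (hKpos _ hgga) (hKpos _ hga))] at hm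
  exact absurd hm (not_le.2 h)

lemma one_sub_mul_deriv_ne_zero {t : ℝ} (ht : 0 ≤ t) {z a : ℂ} (hz : 0 < z.im) (ha : 0 < a.im)
    (hfa : z + t * v a = a) : 1 - t * deriv v a ≠ 0 := by
  intro h
  have h1 := norm_deriv_mul_im_le hd hv ha
  have h2 : t * ‖deriv v a‖ = 1 := by
    have := congrArg norm (sub_eq_zero.1 h).symm
    simpa [abs_of_nonneg ht] using this
  have h3 := congrArg Complex.im hfa
  simp at h3
  have := mul_le_mul_of_nonneg_left h1 ht
  rw [← mul_assoc, h2, one_mul] at this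
  linarith

end FixedPoint

section Flow

variable {v : ℂ → ℂ} (hd : DifferentiableOn ℂ v {z | 0 < z.im})
  (hv : ∀ z : ℂ, 0 < z.im → 0 < (v z).im)
  {ω : ℝ → ℂ → ℂ} (hω : ∀ t z, 0 ≤ t → 0 < z.im → z.im ≤ (ω t z).im ∧ z + t * v (ω t z) = ω t z)

include hd hv hω

/-- Spatial derivative of the inverse characteristic flow. -/
lemma hasDerivAt_flow {t : ℝ} (ht : 0 ≤ t) {z : ℂ} (hz : 0 < z.im) :
    HasDerivAt (ω t) (1 - t * deriv v (ω t z))⁻¹ z := by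
  obtain ⟨h1, h2⟩ := hω t z ht hz
  have hopen : IsOpen {z : ℂ | 0 < z.im} := isOpen_lt continuous_const Complex.continuous_im
  set a := ω t z
  have ha : 0 < a.im := hz.trans_le h1
  have hva : HasStrictDerivAt v (deriv v a) a := (hd.analyticAt (hopen.mem_nhds ha)).hasStrictDerivAt
  have hF : HasStrictDerivAt (fun b => b - t * v b) (1 - t * deriv v a) a :=
    (hasStrictDerivAt_id a).sub (hva.const_mul _)
  have hFa : a - t * v a = z := by linear_combination -h2
  have h := hF.to_local_left_inverse (g := ω t) (one_sub_mul_deriv_ne_zero hd hv ht hz ha h2) ?_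
  · simp only [hFa] at h
    exact h.hasDerivAt
  · have hFcont : ContinuousAt (fun b => b - t * v b) a := hF.hasDerivAt.continuousAt
    have hmem : ∀ᶠ b in 𝓝 a, 0 < (b - t * v b).im :=
      hFcont.eventually (hopen.mem_nhds (show 0 < (a - t * v a).im by rw [hFa]; exact hz))
    filter_upwards [hmem, hopen.mem_nhds ha] with b hb hb'
    obtain ⟨h3, h4⟩ := hω t _ ht hb
    exact fixedPoint_unique hd hv ht hb (hb.trans_le h3) hb' h4 (by ring)

/-- Time derivative of the inverse characteristic flow. -/
lemma hasDerivAt_flow_time {t : ℝ} (ht : 0 < t) {z : ℂ} (hz : 0 < z.im) :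
    HasDerivAt (fun s => ω s z) (v (ω t z) * (1 - t * deriv v (ω t z))⁻¹) t := by
  obtain ⟨h1, h2⟩ := hω t z ht.le hz
  have hopen : IsOpen {z : ℂ | 0 < z.im} := isOpen_lt continuous_const Complex.continuous_im
  set a := ω t z
  have ha : 0 < a.im := hz.trans_le h1
  have hvne : ∀ b : ℂ, 0 < b.im → v b ≠ 0 := fun b hb h0 => by
    have := hv b hb
    simp [h0] at this
  have hva : HasStrictDerivAt v (deriv v a) a := (hd.analyticAt (hopen.mem_nhds ha)).hasStrictDerivAt
  have hne := one_sub_mul_deriv_ne_zero hd hv ht.le hz ha h2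
  have hva0 := hvne a ha
  have hT : HasStrictDerivAt (fun b => (b - z) / v b) ((1 - t * deriv v a) / v a) a := by
    have h := HasStrictDerivAt.fun_div ((hasStrictDerivAt_id a).sub_const z) hva hva0
    refine h.congr_deriv ?_
    have e : id a - z = t * v a := by simp only [id]; linear_combination -h2
    rw [e]
    field_simp
  have hTa : (a - z) / v a = t := by
    rw [div_eq_iff hva0]
    linear_combination -h2
  have hT0 : (1 - t * deriv v a) / v a ≠ 0 := div_ne_zero hne hva0
  set φ := hT.localInverse _ _ _ hT0
  have hφ : HasDerivAt φ ((1 - t * deriv v a) / v a)⁻¹ (t : ℂ) := by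
    have := (hT.to_localInverse hT0).hasDerivAt
    rwa [hTa] at this
  have hφr : ∀ᶠ s in 𝓝 (t : ℂ), (φ s - z) / v (φ s) = s := by
    have := hT.eventually_right_inverse hT0
    rwa [hTa] at this
  have hφt : φ t = a := by
    have := (hT.hasStrictFDerivAt_equiv hT0).localInverse_apply_image
    rwa [hTa] at this
  have hφim : ∀ᶠ s in 𝓝 (t : ℂ), 0 < (φ s).im :=
    hφ.continuousAt.eventually (hopen.mem_nhds (by rw [hφt]; exact ha))
  have hcast : Tendsto (fun s : ℝ => (s : ℂ)) (𝓝 t) (𝓝 (t : ℂ)) :=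
    Complex.continuous_ofReal.tendsto t
  have hfinal := hφ.comp_ofReal
  rw [inv_div, div_eq_mul_inv] at hfinal
  refine hfinal.congr_of_eventuallyEq ?_
  filter_upwards [hcast.eventually hφr, hcast.eventually hφim, eventually_gt_nhds ht] with s h3 h4 h5
  obtain ⟨h6, h7⟩ := hω s z h5.le hz
  refine fixedPoint_unique hd hv h5.le hz (hz.trans_le h6) h4 h7 ?_
  rw [div_eq_iff (hvne _ h4)] at h3
  linear_combination -h3

end Flow

section Drift

lemma im_const_mul_exp_neg {c : ℝ} (hc : 0 < c) {w : ℂ} (h1 : -Real.pi < w.im) (h2 : w.im < 0) :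
    ((c : ℂ) * Complex.exp w).im < 0 := by
  rw [Complex.im_ofReal_mul, Complex.exp_im]
  exact mul_neg_of_pos_of_neg hc
    (mul_neg_of_pos_of_neg (Real.exp_pos _) (Real.sin_neg_of_neg_of_neg_pi_lt h2 h1))

lemma const_mul_exp_add_one_ne_zero {c : ℝ} (hc : 0 < c) {w : ℂ} (h1 : -Real.pi < w.im)
    (h2 : w.im ≤ 0) : (c : ℂ) * Complex.exp w + 1 ≠ 0 := by
  intro h
  rcases h2.lt_or_eq with h2 | h2
  · have h3 := im_const_mul_exp_neg hc h1 h2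
    have := congrArg Complex.im h
    simp only [Complex.add_im, Complex.one_im, Complex.zero_im] at this
    linarith
  · have := congrArg Complex.re h
    have h3 := Real.exp_pos w.re
    simp [Complex.exp_re, h2] at this
    nlinarith

/-- The negative of the characteristic speed `f / (f + 1)`. -/
noncomputable def negSpeed (f : ℂ) : ℂ := -(f / (f + 1))

lemma negSpeed_im_pos {f : ℂ} (hf : f.im < 0) : 0 < (negSpeed f).im := by
  have hne : f + 1 ≠ 0 := fun h => by
    have := congrArg Complex.im h
    simp at this
    linarith
  have hpos : 0 < Complex.normSq (f + 1) := Complex.normSq_pos.2 hne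
  have : (negSpeed f).im = -f.im / Complex.normSq (f + 1) := by
    rw [negSpeed, Complex.neg_im, Complex.div_im]
    simp
    field_simp
    ring
  rw [this]
  exact div_pos (by linarith) hpos

variable {ρ : ℝ → ℝ} (hρ : Integrable ρ) (hb : ∀ᵐ x, ρ x ∈ Icc (0 : ℝ) 1)

include hρ hb

lemma neg_pi_lt_im_stieltjes {z : ℂ} (hz : 0 < z.im) : -Real.pi < (stieltjes ρ z).im := by
  have h0 : 0 ≤ ∫ x, ρ x := integral_nonneg_of_ae (hb.mono fun x hx => hx.1)
  have h := neg_pi_add_le_im_stieltjes hρ hb (L := (∫ x, ρ x) + 1) (by linarith) (by linarith) hz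
  have : 0 < ((∫ x, ρ x) + 1) * (z.im / (((∫ x, ρ x) + 1) ^ 2 + z.im ^ 2)) := by positivity
  linarith

lemma exists_neg_pi_add_le_im_stieltjes {y : ℝ} (hy : 0 < y) :
    ∃ δ > 0, ∀ z : ℂ, y ≤ z.im → -Real.pi + δ ≤ (stieltjes ρ z).im := by
  have h0 : 0 ≤ ∫ x, ρ x := integral_nonneg_of_ae (hb.mono fun x hx => hx.1)
  set M := (∫ x, ρ x) + 1 with hM
  have hM0 : 0 < M := by linarith
  refine ⟨min (1 / 2) (y / (2 * M)), by positivity, fun z hz => ?_⟩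
  have hz0 : 0 < z.im := hy.trans_le hz
  rcases le_total M z.im with h | h
  · refine le_trans ?_ (neg_pi_add_le_im_stieltjes hρ hb hz0 (by linarith) hz0)
    have e : z.im * (z.im / (z.im ^ 2 + z.im ^ 2)) = 1 / 2 := by field_simp; norm_num
    rw [e]
    gcongr
    exact min_le_left _ _
  · refine le_trans ?_ (neg_pi_add_le_im_stieltjes hρ hb hM0 (by linarith) hz0)
    gcongr
    refine (min_le_right _ _).trans ?_
    calc y / (2 * M) ≤ z.im / (2 * M) := by gcongr
      _ = M * (z.im / (M ^ 2 + M ^ 2)) := by field_simp; ring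
      _ ≤ M * (z.im / (M ^ 2 + z.im ^ 2)) := by gcongr

lemma exists_norm_negSpeed_le {c : ℝ} (hc : 0 < c) (hpos : 0 < ∫ x, ρ x) {y : ℝ} (hy : 0 < y) :
    ∃ C : ℝ, ∀ z : ℂ, y ≤ z.im → ‖negSpeed (c * Complex.exp (stieltjes ρ z))‖ ≤ C := by
  obtain ⟨δ, hδ, hδle⟩ := exists_neg_pi_add_le_im_stieltjes hρ hb hy
  set S : Set ℂ := Metric.closedBall 0 ((∫ x, ‖ρ x‖) / y) ∩ {w | -Real.pi + δ ≤ w.im ∧ w.im ≤ 0}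
  have hS : IsCompact S := (isCompact_closedBall _ _).inter_right
    ((isClosed_le continuous_const Complex.continuous_im).inter
      (isClosed_le Complex.continuous_im continuous_const))
  have hcont : ContinuousOn (fun w => negSpeed (c * Complex.exp w)) S := by
    unfold negSpeed
    refine (ContinuousOn.div (by fun_prop) (by fun_prop) fun w hw => ?_).neg
    exact const_mul_exp_add_one_ne_zero hc (by linarith [hw.2.1]) hw.2.2
  obtain ⟨C, hC⟩ := hS.exists_bound_of_continuousOn hcont
  refine ⟨C, fun z hz => hC _ ⟨?_, hδle z hz, ?_⟩⟩
  · rw [mem_closedBall_zero_iff]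
    refine (norm_stieltjes_le hρ (hy.trans_le hz)).trans ?_
    gcongr
  · exact (im_stieltjes_neg hρ hb hpos (hy.trans_le hz)).le

end Drift

/-- Proposition 6.6 of the paper: the complex slope associated with the limit shape of
non-intersecting Bernoulli random walks with drift parameter `β` and initial density `ρ₀`
solves the complex Burgers equation on the upper half-plane. -/
theorem nbrw_complex_burgers
    (β : ℝ) (hβ : β ∈ Set.Ioo (0 : ℝ) 1)
    (ρ₀ : ℝ → ℝ) (hmeas : Measurable ρ₀)
    (hbd : ∀ᵐ x ∂(volume : Measure ℝ), ρ₀ x ∈ Set.Icc (0 : ℝ) 1)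
    (hint : Integrable ρ₀) (hpos : 0 < ∫ x : ℝ, ρ₀ x) :
    ∃ ρ : ℝ → ℝ → ℝ,
      (∀ t, 0 ≤ t → Measurable (ρ t) ∧
        (∀ᵐ x ∂(volume : Measure ℝ), ρ t x ∈ Set.Icc (0 : ℝ) 1) ∧ Integrable (ρ t)) ∧
      ρ 0 =ᵐ[volume] ρ₀ ∧
      (∀ t, 0 ≤ t → ∀ z : ℂ, 0 < z.im → (slopeF β ρ t z).im < 0) ∧
      (∀ t, 0 ≤ t → DifferentiableOn ℂ (slopeF β ρ t) {z : ℂ | 0 < z.im}) ∧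
      (∀ z : ℂ, 0 < z.im → ∀ t : ℝ, 0 < t → DifferentiableAt ℝ (fun s : ℝ => slopeF β ρ s z) t) ∧
      (∀ t : ℝ, 0 < t → ∀ z : ℂ, 0 < z.im →
        deriv (fun s : ℝ => slopeF β ρ s z) t +
          slopeF β ρ t z / (slopeF β ρ t z + 1) * deriv (slopeF β ρ t) z = 0) := by
  have hopen : IsOpen {z : ℂ | 0 < z.im} := isOpen_lt continuous_const Complex.continuous_im
  set c : ℝ := β / (1 - β) with hcdef
  have hc : 0 < c := div_pos hβ.1 (by linarith [hβ.2])
  set m : ℂ → ℂ := stieltjes ρ₀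
  have hmd : DifferentiableOn ℂ m {z | 0 < z.im} := differentiableOn_stieltjes hint
  have hm1 : ∀ z : ℂ, 0 < z.im → -Real.pi < (m z).im := fun z hz =>
    neg_pi_lt_im_stieltjes hint hbd hz
  have hm2 : ∀ z : ℂ, 0 < z.im → (m z).im < 0 := fun z hz => im_stieltjes_neg hint hbd hpos hz
  set f₀ : ℂ → ℂ := fun z => c * Complex.exp (m z) with hf₀
  have hf₀d : DifferentiableOn ℂ f₀ {z | 0 < z.im} := hmd.cexp.const_mul _
  have hf₀im : ∀ z : ℂ, 0 < z.im → (f₀ z).im < 0 := fun z hz =>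
    im_const_mul_exp_neg hc (hm1 z hz) (hm2 z hz)
  set v : ℂ → ℂ := fun z => negSpeed (f₀ z) with hv
  have hvd : DifferentiableOn ℂ v {z | 0 < z.im} := by
    refine (hf₀d.div (hf₀d.add_const _) fun z hz => ?_).neg
    exact const_mul_exp_add_one_ne_zero hc (hm1 z hz) (hm2 z hz).le
  have hvim : ∀ z : ℂ, 0 < z.im → 0 < (v z).im := fun z hz => negSpeed_im_pos (hf₀im z hz)
  have hex : ∀ (t : ℝ) (z : ℂ), 0 ≤ t → 0 < z.im →
      ∃ a : ℂ, z.im ≤ a.im ∧ z + t * v a = a := by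
    intro t z ht hz
    obtain ⟨C, hC⟩ := exists_norm_negSpeed_le hint hbd hc hpos hz
    exact exists_fixedPoint hvd hvim ht hz hC
  choose! ω hω using hex
  have hωim : ∀ t z, 0 ≤ t → 0 < z.im → 0 < (ω t z).im := fun t z ht hz =>
    hz.trans_le (hω t z ht hz).1
  have hωd : ∀ t, 0 ≤ t → DifferentiableOn ℂ (ω t) {z | 0 < z.im} := fun t ht z hz =>
    (hasDerivAt_flow hvd hvim hω ht hz).differentiableAt.differentiableWithinAt
  have hdens : ∀ t : ℝ, 0 ≤ t → ∃ r : ℝ → ℝ, Measurable r ∧ (∀ᵐ x, r x ∈ Icc (0 : ℝ) 1) ∧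
      Integrable r ∧ ∀ z : ℂ, 0 < z.im → stieltjes r z = m (ω t z) := by
    intro t ht
    refine exists_stieltjes_eq (hmd.comp (hωd t ht) fun z hz => hωim t z ht hz)
      (fun z hz => ⟨(hm1 _ (hωim t z ht hz)).le, (hm2 _ (hωim t z ht hz)).le⟩)
      (M := ∫ x, ‖ρ₀ x‖) fun z hz => ?_
    refine (norm_stieltjes_le hint (hωim t z ht hz)).trans ?_
    exact div_le_div_of_nonneg_left (integral_nonneg fun x => norm_nonneg _) hz (hω t z ht hz).1
  have hdens' : ∀ t : ℝ, 0 ≤ t → ∃ r : ℝ → ℝ, (Measurable r ∧ (∀ᵐ x, r x ∈ Icc (0 : ℝ) 1) ∧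
      Integrable r) ∧ (t = 0 → r = ρ₀) ∧ ∀ z : ℂ, 0 < z.im → stieltjes r z = m (ω t z) := by
    intro t ht
    rcases eq_or_ne t 0 with rfl | hne
    · refine ⟨ρ₀, ⟨hmeas, hbd, hint⟩, fun _ => rfl, fun z hz => ?_⟩
      have := (hω 0 z le_rfl hz).2
      simp only [Complex.ofReal_zero, zero_mul, add_zero] at this
      rw [← this]
    · obtain ⟨r, h1, h2, h3, h4⟩ := hdens t ht
      exact ⟨r, ⟨h1, h2, h3⟩, fun h => absurd h hne, h4⟩
  choose! ρ hρ1 hρ2 hρ3 using hdens'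
  have hslope : ∀ t, 0 ≤ t → ∀ z : ℂ, 0 < z.im → slopeF β ρ t z = f₀ (ω t z) := by
    intro t ht z hz
    simp only [slopeF, hf₀, ← hρ3 t ht z hz, stieltjes]
    rfl
  have hf₀at : ∀ t, 0 ≤ t → ∀ z : ℂ, 0 < z.im →
      HasDerivAt f₀ (deriv f₀ (ω t z)) (ω t z) := fun t ht z hz =>
    (hf₀d.differentiableAt (hopen.mem_nhds (hωim t z ht hz))).hasDerivAt
  have hDz : ∀ t, 0 ≤ t → ∀ z : ℂ, 0 < z.im → HasDerivAt (slopeF β ρ t)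
      (deriv f₀ (ω t z) * (1 - t * deriv v (ω t z))⁻¹) z := by
    intro t ht z hz
    refine ((hf₀at t ht z hz).comp z (hasDerivAt_flow hvd hvim hω ht hz)).congr_of_eventuallyEq ?_
    filter_upwards [hopen.mem_nhds hz] with w hw using hslope t ht w hw
  have hDt : ∀ t, 0 < t → ∀ z : ℂ, 0 < z.im → HasDerivAt (fun s => slopeF β ρ s z)
      (deriv f₀ (ω t z) * (v (ω t z) * (1 - t * deriv v (ω t z))⁻¹)) t := by
    intro t ht z hz
    refine ((hf₀at t ht.le z hz).comp t
      (hasDerivAt_flow_time hvd hvim hω ht hz)).congr_of_eventuallyEq ?_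
    filter_upwards [eventually_gt_nhds ht] with s hs using hslope s hs.le z hz
  refine ⟨ρ, hρ1, (hρ2 0 le_rfl rfl) ▸ EventuallyEq.rfl, fun t ht z hz => ?_,
    fun t ht z hz => (hDz t ht z hz).differentiableAt.differentiableWithinAt,
    fun z hz t ht => (hDt t ht z hz).differentiableAt, fun t ht z hz => ?_⟩
  · rw [hslope t ht z hz]
    exact hf₀im _ (hωim t z ht hz)
  · rw [(hDt t ht z hz).deriv, (hDz t ht.le z hz).deriv, hslope t ht.le z hz]
    simp only [hv, negSpeed]
    ring
end

section
/- For every φ ∈ (0, 1/2), K ≥ 1 and ε₃ ∈ (0, 1/12), there exist C > 0 and N ∈ ℕ such that the following holds for all integers n ≥ N. Let B ∈ (φ, 1−φ), let τ₁, τ₂, γ₁, γ₂ ∈ [−K, K] with τ₁ − τ₂ > n^{−ε₃}, and let t₁, t₂, x₁, x₂ ∈ ℤ satisfy |t₁ − t₂ − (τ₁−τ₂)·n^{1/2}| ≤ K and |x₁ − x₂ − B(τ₁−τ₂)·n^{1/2} − (γ₁−γ₂)·n^{1/4}| ≤ K. Then |B^{x₁−x₂}·(1−B)^{(t₁−t₂)−(x₁−x₂)}·binom(t₁−t₂,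 x₁−x₂) − n^{−1/4}·(2π(τ₁−τ₂)B(1−B))^{−1/2}·exp(−(γ₁−γ₂)²/(2B(1−B)(τ₁−τ₂)))| ≤ C·n^{−1/2+3ε₃}. -/
open scoped Real

/-- Binomial coefficient of two integers, interpreted as `0` unless `0 ≤ b ≤ a`. -/
def intBinom (a b : ℤ) : ℕ :=
  if 0 ≤ b ∧ b ≤ a then a.toNat.choose b.toNat else 0

/-- Stirling's formula for `log k!` with an explicit error term. -/
theorem abs_log_factorial_sub_stirling_le {k : ℕ} (hk : 0 < k) :
    |Real.log (k.factorial) - (k * Real.log k - k + Real.log (2 * π * k) / 2)| ≤ 1 / (2 * k) := by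
  have hlow := Stirling.le_log_factorial_stirling hk.ne'
  have hmono : Monotone fun n : ℕ =>
      Real.log (Stirling.stirlingSeq (n + 1)) - 1 / (2 * ((n : ℝ) + 1)) := by
    refine monotone_nat_of_le_succ fun n => ?_
    have h := Stirling.log_stirlingSeq_sdiff_le (n + 1)
    have h2 : (1 : ℝ) / (12 * ((n + 1 : ℕ) : ℝ) * (((n + 1 : ℕ) : ℝ) + 1)) ≤
        1 / (2 * ((n : ℝ) + 1)) - 1 / (2 * ((n : ℝ) + 1 + 1)) := by
      have : (1 : ℝ) / (2 * ((n : ℝ) + 1)) - 1 / (2 * ((n : ℝ) + 1 + 1)) =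
          1 / (2 * ((n : ℝ) + 1) * (n + 1 + 1)) := by
        field_simp; ring
      rw [this]
      apply one_div_le_one_div_of_le (by positivity)
      push_cast
      gcongr
      norm_num
    push_cast at h h2 ⊢
    linarith
  have hlim : Filter.Tendsto (fun n : ℕ =>
      Real.log (Stirling.stirlingSeq (n + 1)) - 1 / (2 * ((n : ℝ) + 1))) Filter.atTop
      (nhds (Real.log √π - 0)) := by
    refine Filter.Tendsto.sub ?_ ?_
    · exact ((Real.continuousAt_log (by positivity)).tendsto.comp
        Stirling.tendsto_stirlingSeq_sqrt_pi).comp (Filter.tendsto_add_atTop_nat 1)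
    · have := (tendsto_one_div_add_atTop_nhds_zero_nat (𝕜 := ℝ)).div_const 2
      refine (this.congr fun n => ?_).trans (by simp)
      rw [div_div, mul_comm]
  obtain ⟨j, rfl⟩ := Nat.exists_eq_succ_of_ne_zero hk.ne'
  have hup := hmono.ge_of_tendsto hlim j
  simp only [Nat.succ_eq_add_one] at *
  rw [Stirling.log_stirlingSeq_formula, Real.log_sqrt Real.pi_pos.le] at hup
  have hj : (0 : ℝ) < ((j + 1 : ℕ) : ℝ) := by positivity
  rw [Real.log_div hj.ne' (Real.exp_ne_zero 1), Real.log_exp,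
    Real.log_mul two_ne_zero hj.ne'] at hup
  rw [Real.log_mul (by positivity) hj.ne', Real.log_mul two_ne_zero Real.pi_ne_zero]
  rw [Real.log_mul two_ne_zero Real.pi_ne_zero] at hlow
  rw [abs_le]
  have : (0 : ℝ) ≤ 1 / (2 * ((j + 1 : ℕ) : ℝ)) := by positivity
  push_cast at *
  constructor <;> linarith

theorem abs_log_one_add_sub_le {u : ℝ} (hu : |u| ≤ 1 / 2) :
    |Real.log (1 + u) - (u - u ^ 2 / 2)| ≤ 2 * |u| ^ 3 := by
  have h := Real.abs_log_sub_add_sum_range_le (x := -u) (by rw [abs_neg]; linarith) 2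
  simp only [Finset.sum_range_succ, Finset.sum_range_zero, abs_neg, sub_neg_eq_add] at h
  have h2 : |u| ^ (2 + 1) / (1 - |u|) ≤ 2 * |u| ^ 3 := by
    rw [div_le_iff₀ (by linarith)]
    have h3 := pow_nonneg (abs_nonneg u) 3
    calc |u| ^ (2 + 1) = 2 * |u| ^ 3 * (1 / 2) := by ring
      _ ≤ 2 * |u| ^ 3 * (1 - |u|) := by gcongr; linarith
  refine le_trans (le_of_eq_of_le (congrArg abs ?_) h) h2
  push_cast
  ring

theorem abs_log_one_add_le {u : ℝ} (hu : |u| ≤ 1 / 2) : |Real.log (1 + u)| ≤ 2 * |u| := by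
  have h := Real.abs_log_sub_add_sum_range_le (x := -u) (by rw [abs_neg]; linarith) 0
  simp only [Finset.sum_range_zero, abs_neg, sub_neg_eq_add, zero_add, pow_one] at h
  refine h.trans ?_
  rw [div_le_iff₀ (by linarith)]
  nlinarith [abs_nonneg u]

theorem abs_one_add_mul_log_sub_le {u : ℝ} (hu : |u| ≤ 1 / 2) :
    |(1 + u) * Real.log (1 + u) - (u + u ^ 2 / 2)| ≤ 4 * |u| ^ 3 := by
  have h := abs_log_one_add_sub_le hu
  have h3 := pow_nonneg (abs_nonneg u) 3
  have e : (1 + u) * Real.log (1 + u) - (u + u ^ 2 / 2) =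
      (1 + u) * (Real.log (1 + u) - (u - u ^ 2 / 2)) - u ^ 3 / 2 := by ring
  have h1 : |1 + u| ≤ 3 / 2 := by
    rw [abs_le] at hu ⊢
    constructor <;> linarith
  calc _ ≤ |1 + u| * |Real.log (1 + u) - (u - u ^ 2 / 2)| + |u| ^ 3 / 2 := by
        rw [e]
        refine (abs_sub _ _).trans ?_
        rw [abs_mul, abs_div, abs_pow, abs_two]
    _ ≤ 3 / 2 * (2 * |u| ^ 3) + |u| ^ 3 / 2 := by gcongr
    _ ≤ 4 * |u| ^ 3 := by linarith

/-- The local de Moivre–Laplace estimate in logarithmic form. -/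
theorem abs_log_binomial_sub_le {φ B : ℝ} (hφ : 0 < φ) (hB : φ ≤ B) (hB' : φ ≤ 1 - B)
    {m l : ℕ} {T y : ℝ} (hT : T = m + l) (hy : y = m - B * T) (hT0 : 0 < T)
    (hyT : |y| ≤ φ * T / 2) :
    |Real.log (B ^ m * (1 - B) ^ l * ((m + l).choose m : ℝ)) -
      (-(Real.log (2 * π * (B * (1 - B)) * T) / 2) - y ^ 2 / (2 * (B * (1 - B)) * T))| ≤
      8 * |y| ^ 3 / (φ * T) ^ 2 + 2 * |y| / (φ * T) + 3 / (φ * T) := by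
  have hB0 : 0 < B := by linarith
  have hB1 : 0 < 1 - B := by linarith
  have hφT : 0 < φ * T := by positivity
  have hp : φ * T ≤ B * T := by gcongr
  have hq : φ * T ≤ (1 - B) * T := by gcongr
  obtain ⟨p, hpd⟩ : ∃ p, p = B * T := ⟨_, rfl⟩
  obtain ⟨q, hqd⟩ : ∃ q, q = (1 - B) * T := ⟨_, rfl⟩
  rw [← hpd] at hp
  rw [← hqd] at hq
  have hp0 : 0 < p := by linarith
  have hq0 : 0 < q := by linarith
  obtain ⟨u, hud⟩ : ∃ u, u = y / p := ⟨_, rfl⟩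
  obtain ⟨v, hvd⟩ : ∃ v, v = -y / q := ⟨_, rfl⟩
  have hua : |u| ≤ |y| / (φ * T) := by
    rw [hud, abs_div, abs_of_pos hp0]; gcongr
  have hva : |v| ≤ |y| / (φ * T) := by
    rw [hvd, abs_div, abs_of_pos hq0, abs_neg]; gcongr
  have hr : |y| / (φ * T) ≤ 1 / 2 := by
    rw [div_le_iff₀ hφT]; linarith
  have hu := hua.trans hr
  have hv := hva.trans hr
  have hpu : p * u = y := by rw [hud]; field_simp
  have hqv : q * v = -y := by rw [hvd]; field_simp
  have hm : (m : ℝ) = p * (1 + u) := by rw [mul_add, hpu, hpd, hy]; ring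
  have hl : (l : ℝ) = q * (1 + v) := by rw [mul_add, hqv, hqd, hy, hT]; ring
  have hu1 : 1 / 2 ≤ 1 + u := by linarith [(abs_le.1 hu).1]
  have hv1 : 1 / 2 ≤ 1 + v := by linarith [(abs_le.1 hv).1]
  have hm2 : φ * T / 2 ≤ m := by rw [hm]; nlinarith
  have hl2 : φ * T / 2 ≤ l := by rw [hl]; nlinarith
  have hm0 : (0 : ℝ) < m := by linarith
  have hl0 : (0 : ℝ) < l := by linarith
  have hmN : 0 < m := by exact_mod_cast hm0
  have hlN : 0 < l := by exact_mod_cast hl0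
  have sm := abs_log_factorial_sub_stirling_le hmN
  have sl := abs_log_factorial_sub_stirling_le hlN
  have sT := abs_log_factorial_sub_stirling_le (Nat.add_pos_left hmN l)
  have hcast : ((m + l : ℕ) : ℝ) = T := by rw [hT]; push_cast; rfl
  rw [hcast] at sT
  have bm : 1 / (2 * (m : ℝ)) ≤ 1 / (φ * T) := by
    apply one_div_le_one_div_of_le hφT; linarith
  have bl : 1 / (2 * (l : ℝ)) ≤ 1 / (φ * T) := by
    apply one_div_le_one_div_of_le hφT; linarith
  have bT : 1 / (2 * T) ≤ 1 / (φ * T) := by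
    apply one_div_le_one_div_of_le hφT; nlinarith
  have hc : ((m + l).choose m : ℝ) ≠ 0 := by
    exact_mod_cast (Nat.choose_pos (Nat.le_add_right m l)).ne'
  have hch : Real.log ((m + l).choose m : ℝ) = Real.log ((m + l).factorial) -
      Real.log (m.factorial) - Real.log (l.factorial) := by
    have h : ((m + l).choose m : ℝ) * m.factorial * l.factorial = (m + l).factorial := by
      rw [Nat.choose_symm_add]
      exact_mod_cast Nat.add_choose_mul_factorial_mul_factorial m l
    rw [← h, Real.log_mul (by positivity) (by positivity), Real.log_mul hc (by positivity)]
    ring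
  have hlm : Real.log m = Real.log B + Real.log T + Real.log (1 + u) := by
    rw [hm, hpd, Real.log_mul (by positivity) (by linarith), Real.log_mul hB0.ne' hT0.ne']
  have hll : Real.log l = Real.log (1 - B) + Real.log T + Real.log (1 + v) := by
    rw [hl, hqd, Real.log_mul (by positivity) (by linarith), Real.log_mul hB1.ne' hT0.ne']
  have eu := abs_one_add_mul_log_sub_le hu
  have ev := abs_one_add_mul_log_sub_le hv
  have lu := abs_log_one_add_le hu
  have lv := abs_log_one_add_le hv
  have cube : ∀ r w : ℝ, φ * T ≤ r → |w| = |y| / r → r * (4 * |w| ^ 3) ≤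
      4 * |y| ^ 3 / (φ * T) ^ 2 := by
    intro r w hr hw
    have hr0 : 0 < r := by linarith
    have : r * (4 * |w| ^ 3) = 4 * |y| ^ 3 / r ^ 2 := by rw [hw]; field_simp
    rw [this]
    gcongr
  have cu := cube p u hp (by rw [hud, abs_div, abs_of_pos hp0])
  have cv := cube q v hq (by rw [hvd, abs_div, abs_of_pos hq0, abs_neg])
  have hquad : y ^ 2 / (2 * (B * (1 - B)) * T) = p * (u ^ 2 / 2) + q * (v ^ 2 / 2) := by
    rw [hud, hvd, hpd, hqd]; field_simp; ring
  have key : Real.log (B ^ m * (1 - B) ^ l * ((m + l).choose m : ℝ)) -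
      (-(Real.log (2 * π * (B * (1 - B)) * T) / 2) - y ^ 2 / (2 * (B * (1 - B)) * T)) =
      (Real.log ((m + l).factorial) - (T * Real.log T - T + Real.log (2 * π * T) / 2)) -
      (Real.log (m.factorial) - (m * Real.log m - m + Real.log (2 * π * m) / 2)) -
      (Real.log (l.factorial) - (l * Real.log l - l + Real.log (2 * π * l) / 2)) -
      p * ((1 + u) * Real.log (1 + u) - (u + u ^ 2 / 2)) -
      q * ((1 + v) * Real.log (1 + v) - (v + v ^ 2 / 2)) -
      Real.log (1 + u) / 2 - Real.log (1 + v) / 2 := by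
    have h2π : (2 * π) ≠ 0 := by positivity
    rw [Real.log_mul (by positivity) hc, Real.log_mul (by positivity) (by positivity),
      Real.log_pow, Real.log_pow, hch, Real.log_mul (by positivity) hT0.ne',
      Real.log_mul h2π (by positivity), Real.log_mul hB0.ne' hB1.ne', hquad,
      Real.log_mul h2π hT0.ne', Real.log_mul h2π hm0.ne', Real.log_mul h2π hl0.ne', hlm, hll]
    have e1 : p * ((1 + u) * Real.log (1 + u) - (u + u ^ 2 / 2)) =
      m * Real.log (1 + u) - y - p * (u ^ 2 / 2) := by rw [hm, ← hpu]; ring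
    have e2 : q * ((1 + v) * Real.log (1 + v) - (v + v ^ 2 / 2)) =
      l * Real.log (1 + v) + y - q * (v ^ 2 / 2) := by
      rw [hl, show y = -(q * v) by rw [hqv]; ring]; ring
    rw [e1, e2]
    rw [show T * Real.log T - T = (m + l) * Real.log T - (m + l) by rw [hT]]
    ring
  rw [key]
  have weight : ∀ r w d : ℝ, 0 < r → |w| ≤ d → |r * w| ≤ r * d := by
    intro r w d hr hw
    rw [abs_mul, abs_of_pos hr]
    gcongr
  have pu' := weight p _ _ hp0 eu
  have qv' := weight q _ _ hq0 ev
  have t1 : 8 * |y| ^ 3 / (φ * T) ^ 2 = 2 * (4 * |y| ^ 3 / (φ * T) ^ 2) := by ring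
  have t2 : 2 * |y| / (φ * T) = 2 * (|y| / (φ * T)) := by ring
  have t3 : 3 / (φ * T) = 3 * (1 / (φ * T)) := by ring
  rw [t1, t2, t3]
  have a1 := abs_le.1 (sm.trans bm)
  have a2 := abs_le.1 (sl.trans bl)
  have a3 := abs_le.1 (sT.trans bT)
  have a4 := abs_le.1 (pu'.trans cu)
  have a5 := abs_le.1 (qv'.trans cv)
  have a6 := abs_le.1 (lu.trans (mul_le_mul_of_nonneg_left hua zero_le_two))
  have a7 := abs_le.1 (lv.trans (mul_le_mul_of_nonneg_left hva zero_le_two))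
  rw [abs_le]
  constructor <;> linarith [a1.1, a1.2, a2.1, a2.2, a3.1, a3.2, a4.1, a4.2, a5.1, a5.2, a6.1, a6.2, a7.1, a7.2]

/-- Perturbing the variance and position parameters of a Gaussian density, in logarithmic form. -/
theorem abs_log_gaussian_sub_le {φ K b a s g T y : ℝ} (hφ : 0 < φ)
    (hb : φ ^ 2 ≤ b) (hK : 1 ≤ K) (ha : 1 ≤ a) (hs : 16 * K * a ≤ s)
    (hg : |g| ≤ 2 * K * a) (hT : |T - s| ≤ K) (hy : |y - g| ≤ 2 * K) :
    |(-(Real.log (2 * π * b * T) / 2) - y ^ 2 / (2 * b * T)) -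
      (-(Real.log (2 * π * b * s) / 2) - g ^ 2 / (2 * b * s))| ≤
      K / s + 12 * K ^ 2 * a / (φ ^ 2 * s) + 4 * K ^ 3 * a ^ 2 / (φ ^ 2 * s ^ 2) := by
  have hK0 : 0 < K := by linarith
  have ha0 : 0 < a := by linarith
  have hKa : K ≤ K * a := by nlinarith
  have hs0 : 0 < s := by nlinarith
  have hT2 : s / 2 ≤ T := by linarith [(abs_le.1 hT).1]
  have hT0 : 0 < T := by linarith
  have hφ2 : 0 < φ ^ 2 := by positivity
  have hb0 : 0 < b := by linarith
  have hu : |(T - s) / s| ≤ K / s := by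
    rw [abs_div, abs_of_pos hs0]; gcongr
  have hu2 : |(T - s) / s| ≤ 1 / 2 := hu.trans (by rw [div_le_iff₀ hs0]; linarith)
  have hlog := (abs_log_one_add_le hu2).trans (mul_le_mul_of_nonneg_left hu zero_le_two)
  have hTs : Real.log (2 * π * b * T) - Real.log (2 * π * b * s) =
      Real.log (1 + (T - s) / s) := by
    rw [← Real.log_div (by positivity) (by positivity)]
    congr 1
    field_simp
    ring
  have hyg : |y + g| ≤ 6 * K * a := by
    have : y + g = (y - g) + 2 * g := by ring
    rw [this]
    refine (abs_add_le _ _).trans ?_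
    rw [abs_mul, abs_two]
    linarith
  have hsq : |g| ^ 2 ≤ (2 * K * a) ^ 2 := by gcongr
  have hnum : |s * ((y - g) * (y + g)) + g ^ 2 * (s - T)| ≤
      s * ((2 * K) * (6 * K * a)) + (2 * K * a) ^ 2 * K := by
    refine (abs_add_le _ _).trans ?_
    rw [abs_mul, abs_mul, abs_mul, abs_of_pos hs0, abs_pow, abs_sub_comm s T]
    gcongr
  have hden : φ ^ 2 * s ^ 2 ≤ 2 * b * T * s := by
    calc φ ^ 2 * s ^ 2 ≤ b * s ^ 2 := by gcongr
      _ = 2 * b * (s / 2) * s := by ring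
      _ ≤ 2 * b * T * s := by gcongr
  have hquad : |y ^ 2 / (2 * b * T) - g ^ 2 / (2 * b * s)| ≤
      12 * K ^ 2 * a / (φ ^ 2 * s) + 4 * K ^ 3 * a ^ 2 / (φ ^ 2 * s ^ 2) := by
    have e : y ^ 2 / (2 * b * T) - g ^ 2 / (2 * b * s) =
        (s * ((y - g) * (y + g)) + g ^ 2 * (s - T)) / (2 * b * T * s) := by
      field_simp; ring
    rw [e, abs_div, abs_of_pos (show 0 < 2 * b * T * s by positivity)]
    calc _ ≤ (s * ((2 * K) * (6 * K * a)) + (2 * K * a) ^ 2 * K) / (φ ^ 2 * s ^ 2) := by gcongr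
      _ = _ := by field_simp; ring
  have a1 := abs_le.1 hlog
  have a2 := abs_le.1 hquad
  rw [abs_le]
  constructor <;> linarith [a1.1, a1.2, a2.1, a2.2]

/-- The binomial probabilities at scale `s`, evaluated at `O(a)` from their mean,
agree with the Gaussian density up to a factor `exp (O(a ^ 3 / s ^ 2))`. -/
theorem abs_log_binomial_sub_log_gaussian_le {φ K B a s g : ℝ} {m l : ℕ}
    (hφ : 0 < φ) (hB : φ ≤ B) (hB' : φ ≤ 1 - B) (hK : 1 ≤ K) (ha : 1 ≤ a)
    (hsa : s ≤ 2 * K * a ^ 2) (hs : 16 * K * a ≤ φ * s) (hg : |g| ≤ 2 * K * a)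
    (hT : |(m + l : ℝ) - s| ≤ K) (hm : |m - B * s - g| ≤ K) :
    |Real.log (B ^ m * (1 - B) ^ l * ((m + l).choose m : ℝ)) -
      (-(Real.log (2 * π * (B * (1 - B)) * s) / 2) - g ^ 2 / (2 * (B * (1 - B)) * s))| ≤
      2200 * K ^ 3 / φ ^ 2 * (a ^ 3 / s ^ 2) := by
  have hK0 : 0 < K := by linarith
  have ha0 : 0 < a := by linarith
  have hKa : K ≤ K * a := by nlinarith
  have hφ1 : φ ≤ 1 := by linarith
  have hs0 : 0 < s := by
    by_contra h
    nlinarith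
  have hs1 : 16 * K * a ≤ s := by nlinarith
  obtain ⟨T, hTd⟩ : ∃ T : ℝ, T = m + l := ⟨_, rfl⟩
  obtain ⟨y, hyd⟩ : ∃ y : ℝ, y = m - B * T := ⟨_, rfl⟩
  rw [← hTd] at hT
  have hyg : |y - g| ≤ 2 * K := by
    have e : y - g = (m - B * s - g) - B * (T - s) := by rw [hyd]; ring
    rw [e]
    refine (abs_sub _ _).trans ?_
    rw [abs_mul, abs_of_nonneg (by linarith : 0 ≤ B)]
    have : B * |T - s| ≤ 1 * K := by gcongr; linarith
    linarith
  have hy : |y| ≤ 4 * K * a := by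
    have : y = (y - g) + g := by ring
    rw [this]
    refine (abs_add_le _ _).trans ?_
    linarith
  have hT2 : s / 2 ≤ T := by linarith [(abs_le.1 hT).1]
  have hT0 : 0 < T := by linarith
  have hφT : φ * s / 2 ≤ φ * T := by nlinarith
  have hφs : 0 < φ * s := by positivity
  have h1 := abs_log_binomial_sub_le hφ hB hB' hTd hyd hT0 (by linarith)
  have hb : φ ^ 2 ≤ B * (1 - B) := by nlinarith
  have h2 := abs_log_gaussian_sub_le hφ hb hK ha hs1 hg hT hyg
  refine (abs_sub_le _ _ _).trans ((add_le_add h1 h2).trans ?_)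
  have d1 : a / s ≤ 2 * K * (a ^ 3 / s ^ 2) := by
    rw [← mul_div_assoc, div_le_div_iff₀ hs0 (by positivity)]
    calc a * s ^ 2 = a * s * s := by ring
      _ ≤ a * s * (2 * K * a ^ 2) := by gcongr
      _ = _ := by ring
  obtain ⟨D, hDd⟩ : ∃ D, D = a ^ 3 / s ^ 2 := ⟨_, rfl⟩
  have hφ2 : 0 < φ ^ 2 := by positivity
  have hφi : 1 / φ ≤ 1 / φ ^ 2 := one_div_le_one_div_of_le hφ2 (by nlinarith)
  have hφi1 : 1 ≤ 1 / φ ^ 2 := by rw [le_div_iff₀ hφ2]; nlinarith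
  have c1 : 8 * |y| ^ 3 / (φ * T) ^ 2 ≤ 2048 * K ^ 3 * (1 / φ ^ 2) * D := by
    calc 8 * |y| ^ 3 / (φ * T) ^ 2 ≤ 8 * (4 * K * a) ^ 3 / (φ * s / 2) ^ 2 := by gcongr
      _ = _ := by rw [hDd]; field_simp; ring
  have c2 : 2 * |y| / (φ * T) ≤ 32 * K ^ 2 * (1 / φ ^ 2) * D := by
    calc 2 * |y| / (φ * T) ≤ 2 * (4 * K * a) / (φ * s / 2) := by gcongr
      _ = 16 * K * (1 / φ) * (a / s) := by field_simp; ring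
      _ ≤ 16 * K * (1 / φ ^ 2) * (2 * K * (a ^ 3 / s ^ 2)) := by gcongr
      _ = _ := by rw [hDd]; ring
  have c3 : 3 / (φ * T) ≤ 12 * K * (1 / φ ^ 2) * D := by
    calc 3 / (φ * T) ≤ 3 * a / (φ * s / 2) := by gcongr; linarith
      _ = 6 * (1 / φ) * (a / s) := by field_simp; ring
      _ ≤ 6 * (1 / φ ^ 2) * (2 * K * (a ^ 3 / s ^ 2)) := by gcongr
      _ = _ := by rw [hDd]; ring
  have c4 : K / s ≤ 2 * K ^ 2 * (1 / φ ^ 2) * D := by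
    calc K / s ≤ K * a / s := by gcongr
      _ = 1 * K * (a / s) := by ring
      _ ≤ (1 / φ ^ 2) * K * (2 * K * (a ^ 3 / s ^ 2)) := by gcongr
      _ = _ := by rw [hDd]; ring
  have c5 : 12 * K ^ 2 * a / (φ ^ 2 * s) ≤ 24 * K ^ 3 * (1 / φ ^ 2) * D := by
    calc 12 * K ^ 2 * a / (φ ^ 2 * s) = 12 * K ^ 2 * (1 / φ ^ 2) * (a / s) := by field_simp
      _ ≤ 12 * K ^ 2 * (1 / φ ^ 2) * (2 * K * (a ^ 3 / s ^ 2)) := by gcongr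
      _ = _ := by rw [hDd]; ring
  have c6 : 4 * K ^ 3 * a ^ 2 / (φ ^ 2 * s ^ 2) ≤ 4 * K ^ 3 * (1 / φ ^ 2) * D := by
    calc 4 * K ^ 3 * a ^ 2 / (φ ^ 2 * s ^ 2) ≤ 4 * K ^ 3 * a ^ 3 / (φ ^ 2 * s ^ 2) := by
          gcongr; norm_num
      _ = _ := by rw [hDd]; field_simp
  have hE : 0 < 1 / φ ^ 2 * D := by rw [hDd]; positivity
  have k2 : K ^ 2 * (1 / φ ^ 2 * D) ≤ K ^ 3 * (1 / φ ^ 2 * D) := by gcongr; norm_num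
  have k1 : K * (1 / φ ^ 2 * D) ≤ K ^ 3 * (1 / φ ^ 2 * D) := by
    gcongr; exact le_self_pow₀ hK (by norm_num)
  have k3 : 0 < K ^ 3 * (1 / φ ^ 2 * D) := by positivity
  rw [← hDd]
  have : 2200 * K ^ 3 / φ ^ 2 * D = 2200 * (K ^ 3 * (1 / φ ^ 2 * D)) := by ring
  rw [this]
  linarith

theorem abs_sub_exp_le_of_abs_log_sub_le {P L δ : ℝ} (hP : 0 < P)
    (h : |Real.log P - L| ≤ δ) (hδ : δ ≤ 1) : |P - Real.exp L| ≤ Real.exp L * (2 * δ) := by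
  have e : P - Real.exp L = Real.exp L * (Real.exp (Real.log P - L) - 1) := by
    rw [mul_sub, ← Real.exp_add, add_sub_cancel, Real.exp_log hP, mul_one]
  rw [e, abs_mul, Real.abs_exp]
  gcongr
  exact (Real.abs_exp_sub_one_le (h.trans hδ)).trans (by linarith)

/-- The comparison of binomial probabilities with the Gaussian density, with explicit constants. -/
theorem abs_binomial_sub_gaussian_le {φ K B a s g : ℝ} {X Y : ℤ}
    (hφ : 0 < φ) (hB : φ ≤ B) (hB' : φ ≤ 1 - B) (hK : 1 ≤ K) (ha : 1 ≤ a)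
    (hsa : s ≤ 2 * K * a ^ 2) (hs : 16 * K * a ≤ φ * s) (hg : |g| ≤ 2 * K * a)
    (hT : |(Y : ℝ) - s| ≤ K) (hm : |X - B * s - g| ≤ K)
    (hsmall : 2200 * K ^ 3 / φ ^ 2 * (a ^ 3 / s ^ 2) ≤ 1) :
    |B ^ X * (1 - B) ^ (Y - X) * (intBinom Y X : ℝ) -
      (2 * π * (B * (1 - B)) * s) ^ (-(1 : ℝ) / 2) *
        Real.exp (-g ^ 2 / (2 * (B * (1 - B)) * s))| ≤
      (2 * π * (B * (1 - B)) * s) ^ (-(1 : ℝ) / 2) *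
        (2 * (2200 * K ^ 3 / φ ^ 2 * (a ^ 3 / s ^ 2))) := by
  have hKa : K ≤ K * a := by nlinarith
  have hs0 : 0 < s := by
    by_contra h
    nlinarith
  have hB0 : 0 < B := by linarith
  have hB1 : 0 < 1 - B := by linarith
  have hb : 0 < B * (1 - B) := by positivity
  have hBs : φ * s ≤ B * s := by gcongr
  have hBs' : φ * s ≤ (1 - B) * s := by gcongr
  have hm' := abs_le.1 hm
  have hT' := abs_le.1 hT
  have hg' := abs_le.1 hg
  have hX : 0 ≤ X := by
    have : (0 : ℝ) ≤ X := by linarith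
    exact_mod_cast this
  have hXY : X ≤ Y := by
    have : (X : ℝ) ≤ Y := by linarith
    exact_mod_cast this
  obtain ⟨m, rfl⟩ := Int.eq_ofNat_of_zero_le hX
  obtain ⟨l, hl⟩ := Int.eq_ofNat_of_zero_le (sub_nonneg.2 hXY)
  obtain rfl : Y = ((m + l : ℕ) : ℤ) := by push_cast; omega
  have hbin : intBinom ((m + l : ℕ) : ℤ) m = (m + l).choose m := by
    rw [intBinom, if_pos ⟨hX, hXY⟩, Int.toNat_natCast, Int.toNat_natCast]
  have hlog := abs_log_binomial_sub_log_gaussian_le (m := m) (l := l) hφ hB hB' hK ha hsa hs hg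
    (by exact_mod_cast hT) (by exact_mod_cast hm)
  have hc : (0 : ℝ) < (m + l).choose m := by
    exact_mod_cast Nat.choose_pos (Nat.le_add_right m l)
  have hV : 0 < 2 * π * (B * (1 - B)) * s := by positivity
  have hexp : Real.exp (-(Real.log (2 * π * (B * (1 - B)) * s) / 2) -
      g ^ 2 / (2 * (B * (1 - B)) * s)) = (2 * π * (B * (1 - B)) * s) ^ (-(1 : ℝ) / 2) *
        Real.exp (-g ^ 2 / (2 * (B * (1 - B)) * s)) := by
    rw [Real.rpow_def_of_pos hV, ← Real.exp_add]
    congr 1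
    ring
  have h := abs_sub_exp_le_of_abs_log_sub_le (by positivity) hlog hsmall
  rw [hexp] at h
  rw [hl, hbin]
  simp only [zpow_natCast]
  refine h.trans ?_
  have hle : Real.exp (-g ^ 2 / (2 * (B * (1 - B)) * s)) ≤ 1 := by
    rw [Real.exp_le_one_iff, neg_div]
    exact neg_nonpos.2 (by positivity)
  gcongr
  exact mul_le_of_le_one_right (by positivity) hle

/-- Lemma 4.18 of the paper: a de Moivre–Laplace type local estimate showing that the
binomial term in the non-intersecting Bernoulli random walk kernel converges to the
Gaussian term in the extended Pearcey kernel under the Pearcey scaling. -/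
theorem binomial_to_gaussian
    (φ K ε : ℝ) (hφ : φ ∈ Set.Ioo (0 : ℝ) (1 / 2)) (hK : 1 ≤ K)
    (hε : ε ∈ Set.Ioo (0 : ℝ) (1 / 12)) :
    ∃ C : ℝ, 0 < C ∧ ∃ N : ℕ, ∀ n : ℕ, N ≤ n →
      ∀ B τ₁ τ₂ γ₁ γ₂ : ℝ, B ∈ Set.Ioo φ (1 - φ) →
        τ₁ ∈ Set.Icc (-K) K → τ₂ ∈ Set.Icc (-K) K →
        γ₁ ∈ Set.Icc (-K) K → γ₂ ∈ Set.Icc (-K) K →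
        (n : ℝ) ^ (-ε) < τ₁ - τ₂ →
        ∀ t₁ t₂ x₁ x₂ : ℤ,
          |((t₁ - t₂ : ℤ) : ℝ) - (τ₁ - τ₂) * (n : ℝ) ^ ((1 : ℝ) / 2)| ≤ K →
          |((x₁ - x₂ : ℤ) : ℝ) - B * (τ₁ - τ₂) * (n : ℝ) ^ ((1 : ℝ) / 2) -
              (γ₁ - γ₂) * (n : ℝ) ^ ((1 : ℝ) / 4)| ≤ K →
          |B ^ (x₁ - x₂) * (1 - B) ^ (t₁ - t₂ - (x₁ - x₂)) *
              (intBinom (t₁ - t₂) (x₁ - x₂) : ℝ) -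
            (n : ℝ) ^ (-(1 : ℝ) / 4) *
              (2 * π * (τ₁ - τ₂) * B * (1 - B)) ^ (-(1 : ℝ) / 2) *
              Real.exp (-(γ₁ - γ₂) ^ 2 / (2 * B * (1 - B) * (τ₁ - τ₂)))| ≤
            C * (n : ℝ) ^ (-(1 : ℝ) / 2 + 3 * ε) := by
  obtain ⟨hφ0, hφ1⟩ := hφ
  obtain ⟨hε0, hε1⟩ := hε
  have hK0 : 0 < K := by linarith
  obtain ⟨C₀, hC₀⟩ : ∃ C₀, C₀ = 2200 * K ^ 3 / φ ^ 2 := ⟨_, rfl⟩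
  have hC₀pos : 0 < C₀ := by rw [hC₀]; positivity
  refine ⟨φ⁻¹ * (2 * C₀), by positivity, ?_⟩
  have ev1 : ∀ᶠ n : ℕ in Filter.atTop, 16 * K / φ ≤ (n : ℝ) ^ (1 / 4 - ε) :=
    ((tendsto_rpow_atTop (by linarith : 0 < 1 / 4 - ε)).comp
      tendsto_natCast_atTop_atTop).eventually_ge_atTop _
  have ev2 : ∀ᶠ n : ℕ in Filter.atTop, C₀ ≤ (n : ℝ) ^ (1 / 4 - 2 * ε) :=
    ((tendsto_rpow_atTop (by linarith : 0 < 1 / 4 - 2 * ε)).comp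
      tendsto_natCast_atTop_atTop).eventually_ge_atTop _
  obtain ⟨N, hN⟩ := Filter.eventually_atTop.1
    ((ev1.and ev2).and (Filter.eventually_ge_atTop 1))
  refine ⟨N, fun n hn B τ₁ τ₂ γ₁ γ₂ hB hτ₁ hτ₂ hγ₁ hγ₂ hτ t₁ t₂ x₁ x₂ ht hx => ?_⟩
  obtain ⟨⟨h1, h2⟩, h3⟩ := hN n hn
  have hn1 : (1 : ℝ) ≤ n := by exact_mod_cast h3
  have hn0 : (0 : ℝ) < n := by linarith
  obtain ⟨τ, hτd⟩ : ∃ τ, τ = τ₁ - τ₂ := ⟨_, rfl⟩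
  obtain ⟨γ, hγd⟩ : ∃ γ, γ = γ₁ - γ₂ := ⟨_, rfl⟩
  rw [← hτd] at hτ ht hx
  rw [← hγd] at hx
  rw [← hτd, ← hγd]
  have hτ0 : 0 < τ := lt_trans (by positivity) hτ
  have hτK : τ ≤ 2 * K := by linarith [hτ₁.2, hτ₂.1]
  have hγK : |γ| ≤ 2 * K := by
    rw [abs_le]; constructor <;> linarith [hγ₁.1, hγ₁.2, hγ₂.1, hγ₂.2]
  obtain ⟨a, had⟩ : ∃ a, a = (n : ℝ) ^ ((1 : ℝ) / 4) := ⟨_, rfl⟩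
  obtain ⟨s, hsd⟩ : ∃ s, s = τ * (n : ℝ) ^ ((1 : ℝ) / 2) := ⟨_, rfl⟩
  have ha2 : (n : ℝ) ^ ((1 : ℝ) / 2) = a ^ 2 := by
    rw [had, ← Real.rpow_natCast, ← Real.rpow_mul hn0.le]; norm_num
  have ha : 1 ≤ a := had ▸ Real.one_le_rpow hn1 (by norm_num)
  have ha0 : 0 < a := by linarith
  have hs0 : 0 < s := by rw [hsd]; positivity
  have hslow : (n : ℝ) ^ (1 / 2 - ε) ≤ s := by
    rw [hsd, show 1 / 2 - ε = -ε + 1 / 2 by ring, Real.rpow_add hn0]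
    gcongr
  have hsa : s ≤ 2 * K * a ^ 2 := by rw [hsd, ha2]; gcongr
  have hs : 16 * K * a ≤ φ * s := by
    rw [div_le_iff₀ hφ0] at h1
    calc 16 * K * a ≤ (n : ℝ) ^ (1 / 4 - ε) * φ * a := by gcongr
      _ = φ * (n : ℝ) ^ (1 / 2 - ε) := by
        rw [show 1 / 2 - ε = (1 / 4 - ε) + 1 / 4 by ring, Real.rpow_add hn0, had]; ring
      _ ≤ φ * s := by gcongr
  have hg : |γ * a| ≤ 2 * K * a := by
    rw [abs_mul, abs_of_pos ha0]; gcongr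
  have hδ : a ^ 3 / s ^ 2 ≤ (n : ℝ) ^ (-1 / 4 + 2 * ε) := by
    rw [div_le_iff₀ (by positivity)]
    calc a ^ 3 = (n : ℝ) ^ (-1 / 4 + 2 * ε) * ((n : ℝ) ^ (1 / 2 - ε)) ^ 2 := by
          rw [had, ← Real.rpow_natCast, ← Real.rpow_natCast, ← Real.rpow_mul hn0.le,
            ← Real.rpow_mul hn0.le, ← Real.rpow_add hn0]
          congr 1
          push_cast
          ring
      _ ≤ _ := by gcongr
  have hsmall : C₀ * (a ^ 3 / s ^ 2) ≤ 1 := by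
    calc C₀ * (a ^ 3 / s ^ 2) ≤ (n : ℝ) ^ (1 / 4 - 2 * ε) * (n : ℝ) ^ (-1 / 4 + 2 * ε) := by
          gcongr
      _ = 1 := by
          rw [← Real.rpow_add hn0]
          ring_nf
          exact Real.rpow_zero _
  have hB1 : 0 < 1 - B := by linarith [hB.2]
  have hB0 : 0 < B := by linarith [hB.1]
  have main := abs_binomial_sub_gaussian_le (X := x₁ - x₂) (Y := t₁ - t₂) hφ0 hB.1.le
    (by linarith [hB.2]) hK ha hsa hs hg (hsd ▸ ht)
    (by rw [hsd, had, ← mul_assoc]; exact hx) (hC₀ ▸ hsmall)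
  rw [← hC₀] at main
  have hG : (n : ℝ) ^ (-(1 : ℝ) / 4) * (2 * π * τ * B * (1 - B)) ^ (-(1 : ℝ) / 2) *
      Real.exp (-γ ^ 2 / (2 * B * (1 - B) * τ)) =
      (2 * π * (B * (1 - B)) * s) ^ (-(1 : ℝ) / 2) *
        Real.exp (-(γ * a) ^ 2 / (2 * (B * (1 - B)) * s)) := by
    congr 1
    · rw [show 2 * π * (B * (1 - B)) * s = (n : ℝ) ^ ((1 : ℝ) / 2) * (2 * π * τ * B * (1 - B)) by
        rw [hsd]; ring, Real.mul_rpow (x := (n : ℝ) ^ ((1 : ℝ) / 2)) (by positivity) (by positivity),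
        ← Real.rpow_mul hn0.le]
      norm_num
    · rw [hsd, ha2]
      congr 1
      field_simp
  rw [hG]
  refine main.trans ?_
  have hpre : (2 * π * (B * (1 - B)) * s) ^ (-(1 : ℝ) / 2) ≤
      φ⁻¹ * (n : ℝ) ^ (-1 / 4 + ε / 2) := by
    have hV : φ ^ 2 * (n : ℝ) ^ (1 / 2 - ε) ≤ 2 * π * (B * (1 - B)) * s := by
      have hb : φ ^ 2 ≤ B * (1 - B) := by nlinarith [hB.1, hB.2]
      have hπ : (1 : ℝ) ≤ 2 * π := by linarith [Real.pi_gt_three]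
      gcongr
      exact hb.trans (le_mul_of_one_le_left (by positivity) hπ)
    calc _ ≤ (φ ^ 2 * (n : ℝ) ^ (1 / 2 - ε)) ^ (-(1 : ℝ) / 2) :=
          Real.rpow_le_rpow_of_nonpos (by positivity) hV (by norm_num)
      _ = _ := by
          rw [Real.mul_rpow (by positivity) (by positivity), ← Real.rpow_mul hn0.le,
            ← Real.rpow_natCast, ← Real.rpow_mul hφ0.le, ← Real.rpow_neg_one]
          congr 2 <;> push_cast <;> ring
  calc _ ≤ φ⁻¹ * (n : ℝ) ^ (-1 / 4 + ε / 2) * (2 * (C₀ * (n : ℝ) ^ (-1 / 4 + 2 * ε))) := by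
        gcongr
    _ = φ⁻¹ * (2 * C₀) * (n : ℝ) ^ ((-1 / 4 + ε / 2) + (-1 / 4 + 2 * ε)) := by
        rw [Real.rpow_add hn0 (-1 / 4 + ε / 2)]; ring
    _ ≤ _ :=
        mul_le_mul_of_nonneg_left (Real.rpow_le_rpow_of_exponent_le hn1 (by linarith))
          (by positivity)
end

section
/- For every φ ∈ (0, 1/2), K ≥ 1 and ε ∈ (0, 1/2), there exist C > 0 and N ∈ ℕ such that the following holds for all integers n ≥ N. Let t_c ∈ [n^{−1/2+ε}, K] with n·z_c ∉ ℤ, where z_c ∈ (−t_c, 0) is such that B := −z_c/t_c ∈ (φ, 1−φ); let t₁, t₂ ≥ 1 and x₁, x₂ be integers with |x₁| ≤ K·n^{1/2}, |x₂| ≤ K·n^{1/2}, |t₁ − n·t_c| ≤ K·n^{1/2}, |t₂ − n·t_c| ≤ K·n^{1/2}, |x₁ − B(t₁ − n·t_c)| ≤ K·n^{1/4}, and |x₂ − B(t₂ − n·t_c)| ≤ K·n^{1/4}. Then | (x₁−x₂)·log B + (t₁−t₂+x₂−x₁)·log(1−B) + log(t₁!) − log((t₂−1)!) + ∑_{i=−x₂+1}^{−x₂+t₂−1}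 log|z_c + i/n| − ∑_{i=−x₁}^{−x₁+t₁} log|z_c + i/n| − (t₁−t₂+1)·log n + log(t_c·B·(1−B)) | ≤ C·n^{−1/2}·t_c^{−1}. -/
/-- The sum `∑ log (s + j)` over `0 ≤ j < k`, a discrete analogue of `log Γ`. -/
noncomputable def logRisingSum (s : ℝ) (k : ℕ) : ℝ :=
  ∑ j ∈ Finset.range k, Real.log (s + j)

/-- The primitive `u log u - u` of the logarithm. -/
noncomputable def logPrimitive (u : ℝ) : ℝ := u * Real.log u - u

lemma logRisingSum_succ (s : ℝ) (k : ℕ) :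
    logRisingSum s (k + 1) = logRisingSum s k + Real.log (s + k) :=
  Finset.sum_range_succ _ _

lemma mul_log_sub_log_le {u v : ℝ} (hu : 0 < u) (hv : 0 < v) :
    u * (Real.log v - Real.log u) ≤ v - u := by
  have h := Real.log_le_sub_one_of_pos (div_pos hv hu)
  rw [Real.log_div hv.ne' hu.ne'] at h
  calc u * (Real.log v - Real.log u) ≤ u * (v / u - 1) :=
        mul_le_mul_of_nonneg_left h hu.le
    _ = v - u := by field_simp

lemma abs_log_sub_log_le {u v m : ℝ} (hm : 0 < m) (hu : m ≤ u) (hv : m ≤ v) :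
    |Real.log u - Real.log v| ≤ |u - v| / m := by
  wlog h : v ≤ u generalizing u v
  · rw [abs_sub_comm, abs_sub_comm u]
    exact this hv hu (le_of_not_ge h)
  have hv0 := hm.trans_le hv
  have hu0 := hm.trans_le hu
  have h1 := mul_log_sub_log_le hv0 hu0
  have h2 := Real.log_le_log hv0 h
  rw [abs_of_nonneg (sub_nonneg.2 h2), abs_of_nonneg (sub_nonneg.2 h), le_div_iff₀ hm]
  nlinarith

lemma abs_log_sub_logPrimitive_succ_le {u : ℝ} (hu : 0 < u) :
    |Real.log u - (logPrimitive (u + 1) - logPrimitive u)| ≤ 1 / u := by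
  have h1 := mul_log_sub_log_le hu (by positivity : 0 < u + 1)
  have h2 := mul_log_sub_log_le (by positivity : 0 < u + 1) hu
  have h3 : Real.log (u + 1) - Real.log u ≤ 1 / u := by
    rw [le_div_iff₀ hu]
    linarith
  unfold logPrimitive
  rw [abs_le]
  constructor <;> nlinarith

lemma abs_logRisingSum_sub_le {s m : ℝ} {k l : ℕ} (hm : 0 < m) (hk : m ≤ s + k)
    (hl : m ≤ s + l) :
    |logRisingSum s k - logRisingSum s l - (logPrimitive (s + k) - logPrimitive (s + l))| ≤
      |(s + k) - (s + l)| / m := by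
  wlog h : l ≤ k generalizing k l
  · have := this hl hk (le_of_not_ge h)
    rw [abs_sub_comm (s + (k : ℝ))]
    rw [← abs_neg]
    convert this using 2
    ring
  rw [add_sub_add_left_eq_sub,
    abs_of_nonneg (sub_nonneg.2 (Nat.cast_le.2 h) : (0 : ℝ) ≤ (k : ℝ) - l)]
  induction k, h using Nat.le_induction with
  | base => simp
  | succ k h ih =>
    have hlk : (l : ℝ) ≤ k := Nat.cast_le.2 h
    have hk' : m ≤ s + k := by linarith
    have ih := ih hk'
    have h1 := abs_log_sub_logPrimitive_succ_le (hm.trans_le hk')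
    have h2 : 1 / (s + k) ≤ 1 / m := one_div_le_one_div_of_le hm hk'
    rw [logRisingSum_succ]
    push_cast
    have h3 : ((k : ℝ) + 1 - l) / m = (k - l) / m + 1 / m := by ring
    rw [h3, ← add_assoc]
    rw [abs_le] at *
    constructor <;> linarith

lemma log_factorial_eq_logRisingSum (k : ℕ) :
    Real.log (k.factorial : ℝ) = logRisingSum 0 (k + 1) := by
  induction k with
  | zero => simp [logRisingSum]
  | succ k ih =>
    rw [logRisingSum_succ, ← ih, Nat.factorial_succ, Nat.cast_mul,
      Real.log_mul (by positivity) (by positivity)]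
    push_cast
    ring_nf

lemma log_abs_add_div {n : ℕ} (hn : 0 < n) {z : ℝ} {i : ℤ} (hi : (i : ℝ) ≠ -(n * z)) :
    Real.log |z + (i : ℝ) / n| = Real.log |(i : ℝ) - -(n * z)| - Real.log n := by
  have hn' : (n : ℝ) ≠ 0 := by positivity
  have h : z + (i : ℝ) / n = ((i : ℝ) - -(n * z)) / n := by
    field_simp
    ring
  rw [Real.log_abs, Real.log_abs, h, Real.log_div (sub_ne_zero.2 hi) hn']

lemma sum_Icc_log_abs_add_div {n : ℕ} (hn : 0 < n) {z : ℝ}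
    (hz : ∀ k : ℤ, (k : ℝ) ≠ n * z) (p q : ℕ) :
    ∑ i ∈ Finset.Icc (⌊-(n * z)⌋ + 1 - p) (⌊-(n * z)⌋ + q), Real.log |z + (i : ℝ) / n| =
      logRisingSum (Int.fract (-(n * z))) p + logRisingSum (1 - Int.fract (-(n * z))) q -
        (p + q) * Real.log n := by
  have hz' : ∀ k : ℤ, (k : ℝ) ≠ -(n * z) := fun k h => hz (-k) (by push_cast; linarith)
  have hf : -(n * z) = ⌊-(n * z)⌋ + Int.fract (-(n * z)) := (Int.floor_add_fract _).symm
  have hf0 := Int.fract_nonneg (-(n * z))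
  have hf1 := Int.fract_lt_one (-(n * z))
  induction q with
  | zero =>
    induction p with
    | zero => simp [logRisingSum]
    | succ p ih =>
      have hI : Finset.Icc (⌊-(n * z)⌋ + 1 - ((p + 1 : ℕ) : ℤ)) (⌊-(n * z)⌋ + (0 : ℕ)) =
          insert (⌊-(n * z)⌋ - (p : ℤ))
            (Finset.Icc (⌊-(n * z)⌋ + 1 - (p : ℤ)) (⌊-(n * z)⌋ + (0 : ℕ))) := by
        ext i
        simp only [Finset.mem_Icc, Finset.mem_insert]
        omega
      have habs : |((⌊-(n * z)⌋ - (p : ℤ) : ℤ) : ℝ) - -(n * z)| =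
          Int.fract (-(n * z)) + p := by
        rw [abs_sub_comm, abs_of_nonneg]
        · push_cast; linarith
        · have : (0 : ℝ) ≤ p := by positivity
          push_cast; linarith
      rw [hI, Finset.sum_insert (by simp), ih, log_abs_add_div hn (hz' _), habs,
        logRisingSum_succ]
      push_cast
      ring
  | succ q ih =>
    have hI : Finset.Icc (⌊-(n * z)⌋ + 1 - (p : ℤ)) (⌊-(n * z)⌋ + ((q + 1 : ℕ) : ℤ)) =
        insert (⌊-(n * z)⌋ + 1 + (q : ℤ))
          (Finset.Icc (⌊-(n * z)⌋ + 1 - (p : ℤ)) (⌊-(n * z)⌋ + (q : ℤ))) := by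
      ext i
      simp only [Finset.mem_Icc, Finset.mem_insert]
      omega
    have habs : |((⌊-(n * z)⌋ + 1 + (q : ℤ) : ℤ) : ℝ) - -(n * z)| =
        1 - Int.fract (-(n * z)) + q := by
      rw [abs_of_nonneg]
      · push_cast; linarith
      · have : (0 : ℝ) ≤ q := by positivity
        push_cast; linarith
    rw [hI, Finset.sum_insert (by simp only [Finset.mem_Icc]; omega), ih,
      log_abs_add_div hn (hz' _), habs, logRisingSum_succ]
    push_cast
    ring

/-- Relative entropy is nonnegative and at most the chi-square divergence, for the two-point
masses `(p, q)` and `((p + q) * b, (p + q) * (1 - b))`. -/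
lemma logPrimitive_entropy_bounds {p q b : ℝ} (hp : 0 < p) (hq : 0 < q) (hb : 0 < b)
    (hb1 : b < 1) :
    -((p - b * (p + q)) ^ 2 / ((p + q) * (b * (1 - b)))) ≤
        logPrimitive (p + q) - logPrimitive p - logPrimitive q + p * Real.log b +
          q * Real.log (1 - b) ∧
      logPrimitive (p + q) - logPrimitive p - logPrimitive q + p * Real.log b +
          q * Real.log (1 - b) ≤ 0 := by
  have hc : 0 < 1 - b := sub_pos.2 hb1
  have ht : 0 < p + q := add_pos hp hq
  have hlb := Real.log_mul ht.ne' hb.ne'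
  have hlc := Real.log_mul ht.ne' hc.ne'
  have u1 := mul_log_sub_log_le hp (mul_pos ht hb)
  have u2 := mul_log_sub_log_le hq (mul_pos ht hc)
  have l1 := Real.log_le_sub_one_of_pos (div_pos hp (mul_pos ht hb))
  have l2 := Real.log_le_sub_one_of_pos (div_pos hq (mul_pos ht hc))
  rw [Real.log_div hp.ne' (mul_pos ht hb).ne', hlb] at l1
  rw [Real.log_div hq.ne' (mul_pos ht hc).ne', hlc] at l2
  rw [hlb] at u1
  rw [hlc] at u2
  have l1' := mul_le_mul_of_nonneg_left l1 hp.le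
  have l2' := mul_le_mul_of_nonneg_left l2 hq.le
  have key : (p - b * (p + q)) ^ 2 / ((p + q) * (b * (1 - b))) =
      p * (p / ((p + q) * b) - 1) + q * (q / ((p + q) * (1 - b)) - 1) := by
    field_simp
    ring
  unfold logPrimitive
  rw [key]
  constructor <;> linarith

/-- The estimate in scaled variables: `T` stands for `n * tc`, the pairs `(p₁, q₁)`, `(p₂, q₂)`
for the distances from the saddle point to the ends of the two summation ranges, and `R` for
`√n`. -/
lemma abs_entropy_difference_le {K R T φ B p₁ q₁ p₂ q₂ : ℝ} (hK : 1 ≤ K) (hR : 0 ≤ R)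
    (hT : 0 < T) (hφ : φ ∈ Set.Ioo (0 : ℝ) (1 / 2)) (hB : B ∈ Set.Ioo φ (1 - φ))
    (hTR : 4 * K * R ≤ φ * T)
    (hx₁ : |p₁ - B * T| ≤ K * R) (hx₂ : |p₂ - B * T| ≤ K * R)
    (ht₁ : |p₁ + q₁ - T| ≤ K * R) (ht₂ : |p₂ + q₂ - T| ≤ K * R)
    (hd₁ : (p₁ - B * (p₁ + q₁)) ^ 2 ≤ K ^ 2 * R)
    (hd₂ : (p₂ - B * (p₂ + q₂)) ^ 2 ≤ K ^ 2 * R)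
    {s₁ s₂ s₃ : ℝ} {k₁ k₂ l₁ l₂ m₁ m₂ : ℕ}
    (hk₁ : s₁ + k₁ = p₁ + q₁) (hk₂ : s₁ + k₂ = p₂ + q₂)
    (hl₁ : s₂ + l₁ = p₁) (hl₂ : s₂ + l₂ = p₂) (hm₁ : s₃ + m₁ = q₁) (hm₂ : s₃ + m₂ = q₂) :
    |(p₁ - p₂) * Real.log B + (q₁ - q₂) * Real.log (1 - B) +
        (logRisingSum s₁ (k₁ + 1) - logRisingSum s₁ k₂) -
        (logRisingSum s₂ (l₁ + 1) - logRisingSum s₂ l₂) -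
        (logRisingSum s₃ (m₁ + 1) - logRisingSum s₃ m₂) + Real.log (T * B * (1 - B))| ≤
      28 * K ^ 2 / φ * (R / T) := by
  obtain ⟨hφ0, hφ1⟩ := hφ
  obtain ⟨hB0, hB1⟩ := hB
  have hBpos : 0 < B := hφ0.trans hB0
  have hCpos : 0 < 1 - B := by linarith
  have hBC : φ / 2 ≤ B * (1 - B) := by
    linarith [mul_nonneg (sub_nonneg.2 hB0.le) (sub_nonneg.2 hB1.le),
      mul_nonneg hφ0.le (sub_nonneg.2 hφ1.le)]
  set M := φ * T / 2 with hM
  have hMpos : 0 < M := by positivity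
  have hKR : 0 ≤ K * R := by positivity
  have hBT : φ * T ≤ B * T := by gcongr
  have hCT : φ * T ≤ (1 - B) * T := by gcongr; linarith
  have hφT : φ * T ≤ T / 2 := by linarith [mul_le_mul_of_nonneg_right hφ1.le hT.le]
  obtain ⟨hx₁l, hx₁u⟩ := abs_le.1 hx₁
  obtain ⟨hx₂l, hx₂u⟩ := abs_le.1 hx₂
  obtain ⟨ht₁l, ht₁u⟩ := abs_le.1 ht₁
  obtain ⟨ht₂l, ht₂u⟩ := abs_le.1 ht₂
  have hp₁ : M ≤ p₁ := by linarith
  have hp₂ : M ≤ p₂ := by linarith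
  have hq₁ : M ≤ q₁ := by linarith
  have hq₂ : M ≤ q₂ := by linarith
  have hT₁ : T / 2 ≤ p₁ + q₁ := by linarith
  have hT₂ : T / 2 ≤ p₂ + q₂ := by linarith
  have e₁ := abs_logRisingSum_sub_le hMpos (by rw [hk₁]; linarith) (by rw [hk₂]; linarith)
  have e₂ := abs_logRisingSum_sub_le hMpos (hp₁.trans_eq hl₁.symm) (hp₂.trans_eq hl₂.symm)
  have e₃ := abs_logRisingSum_sub_le hMpos (hq₁.trans_eq hm₁.symm) (hq₂.trans_eq hm₂.symm)
  have a₁ : |p₁ + q₁ - (p₂ + q₂)| / M ≤ 2 * (K * R) / M := by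
    gcongr
    rw [abs_le]; constructor <;> linarith
  have a₂ : |p₁ - p₂| / M ≤ 2 * (K * R) / M := by
    gcongr
    rw [abs_le]; constructor <;> linarith
  have a₃ : |q₁ - q₂| / M ≤ 4 * (K * R) / M := by
    gcongr
    rw [abs_le]; constructor <;> linarith
  have b₁ : |Real.log (p₁ + q₁) - Real.log T| ≤ K * R / M :=
    (abs_log_sub_log_le hMpos (by linarith) (by linarith)).trans (by gcongr)
  have b₂ : |Real.log p₁ - Real.log (B * T)| ≤ K * R / M :=
    (abs_log_sub_log_le hMpos hp₁ (by linarith)).trans (by gcongr)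
  have b₃ : |Real.log q₁ - Real.log ((1 - B) * T)| ≤ 2 * (K * R) / M :=
    (abs_log_sub_log_le hMpos hq₁ (by linarith)).trans
      (by gcongr; rw [abs_le]; constructor <;> linarith)
  obtain ⟨g₁l, g₁u⟩ := logPrimitive_entropy_bounds (hMpos.trans_le hp₁) (hMpos.trans_le hq₁)
    hBpos (by linarith : B < 1)
  obtain ⟨g₂l, g₂u⟩ := logPrimitive_entropy_bounds (hMpos.trans_le hp₂) (hMpos.trans_le hq₂)
    hBpos (by linarith : B < 1)
  have c₁ : (p₁ - B * (p₁ + q₁)) ^ 2 / ((p₁ + q₁) * (B * (1 - B))) ≤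
      K ^ 2 * R / (T / 2 * (φ / 2)) := by gcongr; linarith
  have c₂ : (p₂ - B * (p₂ + q₂)) ^ 2 / ((p₂ + q₂) * (B * (1 - B))) ≤
      K ^ 2 * R / (T / 2 * (φ / 2)) := by gcongr; linarith
  rw [hk₁, hk₂] at e₁
  rw [hl₁, hl₂] at e₂
  rw [hm₁, hm₂] at e₃
  rw [Real.log_mul hBpos.ne' hT.ne'] at b₂
  rw [Real.log_mul hCpos.ne' hT.ne'] at b₃
  rw [logRisingSum_succ, logRisingSum_succ, logRisingSum_succ, hk₁, hl₁, hm₁,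
    Real.log_mul (by positivity) hCpos.ne', Real.log_mul hT.ne' hBpos.ne']
  have total : 12 * (K * R / M) + K ^ 2 * R / (T / 2 * (φ / 2)) ≤
      28 * K ^ 2 / φ * (R / T) := by
    have h₁ : 12 * (K * R / M) + K ^ 2 * R / (T / 2 * (φ / 2)) =
        (24 * K + 4 * K ^ 2) / φ * (R / T) := by
      rw [hM]; field_simp; ring
    rw [h₁]
    gcongr
    linarith [mul_le_mul_of_nonneg_left hK (zero_le_one.trans hK)]
  have d₂ : 2 * (K * R) / M = 2 * (K * R / M) := by ring
  have d₄ : 4 * (K * R) / M = 4 * (K * R / M) := by ring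
  rw [d₂] at a₁ a₂ b₃
  rw [d₄] at a₃
  have e₁' := abs_le.1 (e₁.trans a₁)
  have e₂' := abs_le.1 (e₂.trans a₂)
  have e₃' := abs_le.1 (e₃.trans a₃)
  rw [abs_le] at b₁ b₂ b₃
  refine le_trans (abs_le.2 ⟨?_, ?_⟩) total <;> linarith

/-- Lemma 4.17 of the paper: a Stirling-type asymptotic identity evaluating, at the saddle
point `z_c`, the prefactor `B^{x₁−x₂}(1−B)^{t₁−t₂+x₂−x₁}·t₁!/(t₂−1)!` together with the
difference `n·D₂(z_c) − n·D₁(z_c)` of the two key functions of the steepest-descent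
analysis. -/
theorem saddle_point_prefactor_estimate
    (φ K ε : ℝ) (hφ : φ ∈ Set.Ioo (0 : ℝ) (1 / 2)) (hK : 1 ≤ K)
    (hε : ε ∈ Set.Ioo (0 : ℝ) (1 / 2)) :
    ∃ C : ℝ, 0 < C ∧ ∃ N : ℕ, ∀ n : ℕ, N ≤ n →
      ∀ tc zc B : ℝ,
        (n : ℝ) ^ (-(1 : ℝ) / 2 + ε) ≤ tc → tc ≤ K →
        (∀ k : ℤ, (k : ℝ) ≠ n * zc) →
        -tc < zc → zc < 0 → B = -zc / tc → B ∈ Set.Ioo φ (1 - φ) →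
      ∀ t₁ t₂ : ℕ, 1 ≤ t₁ → 1 ≤ t₂ →
      ∀ x₁ x₂ : ℤ,
        |(x₁ : ℝ)| ≤ K * (n : ℝ) ^ ((1 : ℝ) / 2) →
        |(x₂ : ℝ)| ≤ K * (n : ℝ) ^ ((1 : ℝ) / 2) →
        |(t₁ : ℝ) - n * tc| ≤ K * (n : ℝ) ^ ((1 : ℝ) / 2) →
        |(t₂ : ℝ) - n * tc| ≤ K * (n : ℝ) ^ ((1 : ℝ) / 2) →
        |(x₁ : ℝ) - B * ((t₁ : ℝ) - n * tc)| ≤ K * (n : ℝ) ^ ((1 : ℝ) / 4) →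
        |(x₂ : ℝ) - B * ((t₂ : ℝ) - n * tc)| ≤ K * (n : ℝ) ^ ((1 : ℝ) / 4) →
        |((x₁ - x₂ : ℤ) : ℝ) * Real.log B +
            ((t₁ : ℝ) - (t₂ : ℝ) + ((x₂ - x₁ : ℤ) : ℝ)) * Real.log (1 - B) +
            Real.log (t₁.factorial : ℝ) - Real.log ((t₂ - 1).factorial : ℝ) +
            (∑ i ∈ Finset.Icc (-x₂ + 1) (-x₂ + (t₂ : ℤ) - 1),
              Real.log |zc + (i : ℝ) / n|) -
            (∑ i ∈ Finset.Icc (-x₁) (-x₁ + (t₁ : ℤ)),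
              Real.log |zc + (i : ℝ) / n|) -
            ((t₁ : ℝ) - (t₂ : ℝ) + 1) * Real.log n +
            Real.log (tc * B * (1 - B))| ≤
          C * (n : ℝ) ^ (-(1 : ℝ) / 2) / tc := by
  obtain ⟨hφ0, hφ1⟩ := id hφ
  have hK0 : 0 < K := by linarith
  refine ⟨28 * K ^ 2 / φ, by positivity, ?_⟩
  have hlim : Filter.Tendsto (fun n : ℕ => (n : ℝ) ^ ε) Filter.atTop Filter.atTop :=
    (tendsto_rpow_atTop hε.1).comp tendsto_natCast_atTop_atTop
  obtain ⟨N, hN⟩ := Filter.eventually_atTop.1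
    ((hlim.eventually_ge_atTop (4 * K / φ)).and (Filter.eventually_ge_atTop 1))
  refine ⟨N, fun n hn tc zc B htc _ hz _ _ hBdef hB t₁ t₂ ht₁ ht₂ x₁ x₂ hx₁ hx₂ hT₁ hT₂
    hd₁ hd₂ => ?_⟩
  obtain ⟨hnε, hn1⟩ := hN n hn
  have hn0 : (0 : ℝ) < n := by exact_mod_cast hn1
  set R := (n : ℝ) ^ ((1 : ℝ) / 2) with hR
  have hR0 : 0 < R := by positivity
  have htc0 : 0 < tc := lt_of_lt_of_le (by positivity) htc
  have hT0 : 0 < n * tc := by positivity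
  have hTR : 4 * K * R ≤ φ * (n * tc) := by
    have h₁ : (n : ℝ) * (n : ℝ) ^ (-(1 : ℝ) / 2 + ε) = R * (n : ℝ) ^ ε := by
      rw [hR, ← Real.rpow_add hn0, ← Real.rpow_one_add' hn0.le]
      · ring_nf
      · linarith [hε.1]
    have h₂ : R * (n : ℝ) ^ ε ≤ n * tc := h₁ ▸ mul_le_mul_of_nonneg_left htc hn0.le
    rw [div_le_iff₀ hφ0] at hnε
    nlinarith
  have hR4 : ((n : ℝ) ^ ((1 : ℝ) / 4)) ^ 2 = R := by
    rw [hR, ← Real.rpow_natCast, ← Real.rpow_mul hn0.le]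
    norm_num
  have hBT : -(n * zc) = B * (n * tc) := by
    rw [hBdef]; field_simp
  have hfl : (⌊-(n * zc)⌋ : ℝ) + Int.fract (-(n * zc)) = B * (n * tc) := by
    rw [Int.floor_add_fract, hBT]
  have hf0 := Int.fract_nonneg (-(n * zc))
  have hf1 := Int.fract_lt_one (-(n * zc))
  have hBφ : φ * (n * tc) ≤ B * (n * tc) := by gcongr; exact hB.1.le
  have hCφ : φ * (n * tc) ≤ (1 - B) * (n * tc) := by gcongr; linarith [hB.2]
  have hKR : 0 < K * R := by positivity
  have lower : ∀ x : ℤ, |(x : ℝ)| ≤ K * R → ∃ l : ℕ, (l : ℤ) = ⌊-(n * zc)⌋ + x := by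
    intro x hx
    have : (-1 : ℝ) < (⌊-(n * zc)⌋ + x : ℤ) := by
      push_cast
      linarith [(abs_le.1 hx).1]
    have : (-1 : ℤ) < ⌊-(n * zc)⌋ + x := by exact_mod_cast this
    exact Int.eq_ofNat_of_zero_le (by omega) |>.imp fun _ h => h.symm
  have upper : ∀ (t : ℕ) (x : ℤ), |(x : ℝ)| ≤ K * R → |(t : ℝ) - n * tc| ≤ K * R →
      ∃ l : ℕ, (l : ℤ) = t - x - ⌊-(n * zc)⌋ - 1 := by
    intro t x hx ht
    have : (-1 : ℝ) < (t - x - ⌊-(n * zc)⌋ - 1 : ℤ) := by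
      push_cast
      linarith [(abs_le.1 hx).2, (abs_le.1 ht).1]
    have : (-1 : ℤ) < t - x - ⌊-(n * zc)⌋ - 1 := by exact_mod_cast this
    exact Int.eq_ofNat_of_zero_le (by omega) |>.imp fun _ h => h.symm
  have square : ∀ y : ℝ, |y| ≤ K * (n : ℝ) ^ ((1 : ℝ) / 4) → y ^ 2 ≤ K ^ 2 * R := by
    intro y hy
    rw [← hR4, ← mul_pow, ← sq_abs]
    gcongr
  obtain ⟨l₁, hl₁⟩ := lower x₁ hx₁
  obtain ⟨l₂, hl₂⟩ := lower x₂ hx₂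
  obtain ⟨m₁, hm₁⟩ := upper t₁ x₁ hx₁ hT₁
  obtain ⟨m₂, hm₂⟩ := upper t₂ x₂ hx₂ hT₂
  have hl₁' : (l₁ : ℝ) = ⌊-(n * zc)⌋ + x₁ := by exact_mod_cast congrArg (Int.cast (R := ℝ)) hl₁
  have hl₂' : (l₂ : ℝ) = ⌊-(n * zc)⌋ + x₂ := by exact_mod_cast congrArg (Int.cast (R := ℝ)) hl₂
  have hm₁' : (m₁ : ℝ) = t₁ - x₁ - ⌊-(n * zc)⌋ - 1 := by
    exact_mod_cast congrArg (Int.cast (R := ℝ)) hm₁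
  have hm₂' : (m₂ : ℝ) = t₂ - x₂ - ⌊-(n * zc)⌋ - 1 := by
    exact_mod_cast congrArg (Int.cast (R := ℝ)) hm₂
  have main := abs_entropy_difference_le (K := K) (R := R) (T := n * tc) (B := B)
    (p₁ := B * (n * tc) + x₁) (q₁ := t₁ - (B * (n * tc) + x₁))
    (p₂ := B * (n * tc) + x₂) (q₂ := t₂ - (B * (n * tc) + x₂))
    (s₁ := 0) (s₂ := Int.fract (-(n * zc))) (s₃ := 1 - Int.fract (-(n * zc)))
    (k₁ := t₁) (k₂ := t₂) (l₁ := l₁) (l₂ := l₂) (m₁ := m₁) (m₂ := m₂)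
    hK hR0.le hT0 hφ hB hTR (by rwa [add_sub_cancel_left]) (by rwa [add_sub_cancel_left])
    (by rwa [add_sub_cancel]) (by rwa [add_sub_cancel])
    (by convert square _ hd₁ using 2; ring) (by convert square _ hd₂ using 2; ring)
    (by ring) (by ring) (by linarith) (by linarith) (by linarith) (by linarith)
  have S₂ : ∑ i ∈ Finset.Icc (-x₂ + 1) (-x₂ + (t₂ : ℤ) - 1), Real.log |zc + (i : ℝ) / n| = _ :=
    Eq.trans (by congr 2 <;> omega) (sum_Icc_log_abs_add_div hn1 hz l₂ m₂)
  have S₁ : ∑ i ∈ Finset.Icc (-x₁) (-x₁ + (t₁ : ℤ)), Real.log |zc + (i : ℝ) / n| = _ :=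
    Eq.trans (by congr 2 <;> push_cast <;> omega)
      (sum_Icc_log_abs_add_div hn1 hz (l₁ + 1) (m₁ + 1))
  have hlog : Real.log (n * tc * B * (1 - B)) = Real.log n + Real.log (tc * B * (1 - B)) := by
    have hB0 : 0 < B := hφ0.trans hB.1
    have hB1 : 0 < 1 - B := by linarith [hB.2]
    rw [← Real.log_mul hn0.ne' (by positivity)]
    ring_nf
  have hbound : 28 * K ^ 2 / φ * (n : ℝ) ^ (-(1 : ℝ) / 2) / tc =
      28 * K ^ 2 / φ * (R / (n * tc)) := by
    have : (n : ℝ) ^ (-(1 : ℝ) / 2) = R / n := by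
      rw [hR, ← Real.rpow_sub_one hn0.ne']
      norm_num
    rw [this]
    field_simp
  rw [S₁, S₂, hbound, log_factorial_eq_logRisingSum, log_factorial_eq_logRisingSum,
    Nat.sub_add_cancel ht₂]
  refine Eq.trans_le (congrArg _ ?_) main
  rw [hlog]
  push_cast
  rw [hl₁', hl₂', hm₁', hm₂']
  ring
end
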